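/- Let ℓ be a prime and let G, H₁, H₂ be subgroups of GL₂(ℤ/ℓℤ) with sig(H₁) = sig(H₂) = sig(G). If neither H₁ nor H₂ is conjugate to G in GL₂(ℓ), then H₁ and H₂ are conjugate to each other in GL₂(ℓ). In other words, for every subgroup G of GL₂(ℓ) there is at most one conjugacy class of subgroups not conjugate to G that have the same signature as G. -/

import Mathlib

open Matrix

/-- `GL₂(ℤ/ℓℤ)`. -/
abbrev GL2 (ℓ : ℕ) := GL (Fin 2) (ZMod ℓ)

/-- The underlying matrix of an element of `GL₂(ℤ/ℓℤ)`. -/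
def mat {ℓ : ℕ} (g : GL2 ℓ) : Matrix (Fin 2) (Fin 2) (ZMod ℓ) := g

/-- `dim₁ g`, the dimension of the eigenspace `ker(g − 1)` of `g` acting on `(ℤ/ℓℤ)²`. -/
noncomputable def dimOne {ℓ : ℕ} (g : GL2 ℓ) : ℕ :=
  Module.finrank (ZMod ℓ) (LinearMap.ker (Matrix.toLin' (mat g - 1)))

/-- `sig(g) = (det g, tr g, dim₁ g)`. -/
noncomputable def sigOf {ℓ : ℕ} (g : GL2 ℓ) : ZMod ℓ × ZMod ℓ × ℕ :=
  ((mat g).det, (mat g).trace, dimOne g)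

/-- The signature `sig(G) = {sig(g) : g ∈ G}` of a subgroup of `GL₂(ℤ/ℓℤ)`. -/
noncomputable def sigSet {ℓ : ℕ} (G : Subgroup (GL2 ℓ)) : Set (ZMod ℓ × ZMod ℓ × ℕ) :=
  {s | ∃ g ∈ G, sigOf g = s}

/-- Subgroups `H`, `K` of `GL₂(ℤ/ℓℤ)` are conjugate if `K = gHg⁻¹` for some `g`. -/
def ConjSub {ℓ : ℕ} (H K : Subgroup (GL2 ℓ)) : Prop :=
  ∃ c : GL2 ℓ, Subgroup.map (MulAut.conj c).toMonoidHom H = K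

section MatrixLemmas

variable {F : Type*} [Field F]

/-- The matrix is a scalar multiple of the identity. -/
def IsScalarMat (A : Matrix (Fin 2) (Fin 2) F) : Prop :=
  A 0 1 = 0 ∧ A 1 0 = 0 ∧ A 0 0 = A 1 1

/-- The matrix with columns `(x, y)` and `A (x, y)`. -/
def krylov (A : Matrix (Fin 2) (Fin 2) F) (x y : F) : Matrix (Fin 2) (Fin 2) F :=
  !![x, A 0 0 * x + A 0 1 * y; y, A 1 0 * x + A 1 1 * y]

lemma mul_krylov (A : Matrix (Fin 2) (Fin 2) F) (x y : F) :
    A * krylov A x y = krylov A x y * !![0, -A.det; 1, A.trace] := by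
  ext i j
  fin_cases i <;> fin_cases j <;>
    simp [krylov, Matrix.mul_apply, Fin.sum_univ_two, Matrix.det_fin_two,
      Matrix.trace_fin_two] <;> ring

lemma mul_krylov_of_eq (A B : Matrix (Fin 2) (Fin 2) F) (x y α β : F)
    (h0 : B 0 0 * x + B 0 1 * y = α * x + β * (A 0 0 * x + A 0 1 * y))
    (h1 : B 1 0 * x + B 1 1 * y = α * y + β * (A 1 0 * x + A 1 1 * y)) :
    B * krylov A x y = krylov A x y *
      !![α, β * A.det + A.trace * α + (A * B).trace - A.trace * B.trace;
        β, B.trace - α] := by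
  ext i j
  fin_cases i <;> fin_cases j <;>
    simp [krylov, Matrix.mul_apply, Fin.sum_univ_two, Matrix.det_fin_two,
      Matrix.trace_fin_two]
  · linear_combination h0
  · linear_combination (A 1 1) * h0 - (A 0 1) * h1
  · linear_combination h1
  · linear_combination (A 0 0) * h1 - (A 1 0) * h0

lemma exists_krylov_det_ne_zero (A : Matrix (Fin 2) (Fin 2) F) (hA : ¬ IsScalarMat A) :
    ∃ x y, (krylov A x y).det ≠ 0 := by
  by_contra! h
  have h1 := h 1 0
  have h2 := h 0 1
  have h3 := h 1 1
  simp [krylov, Matrix.det_fin_two] at h1 h2 h3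
  apply hA
  refine ⟨h2, h1, ?_⟩
  rw [h1, h2] at h3
  linear_combination -h3

lemma conj_of_krylov {A A' P P' M : Matrix (Fin 2) (Fin 2) F} (p p' : GL (Fin 2) F)
    (hp : (p : Matrix (Fin 2) (Fin 2) F) = P) (hp' : (p' : Matrix (Fin 2) (Fin 2) F) = P')
    (h : A * P = P * M) (h' : A' * P' = P' * M) :
    ((p' * p⁻¹ : GL (Fin 2) F) : Matrix (Fin 2) (Fin 2) F) * A
      = A' * ((p' * p⁻¹ : GL (Fin 2) F) : Matrix (Fin 2) (Fin 2) F) := by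
  subst hp hp'
  have e : M = (↑p⁻¹ : Matrix (Fin 2) (Fin 2) F) * A * (p : Matrix (Fin 2) (Fin 2) F) := by
    rw [mul_assoc, h, ← mul_assoc, Units.inv_mul, one_mul]
  rw [Units.val_mul, ← mul_assoc, h', e]
  simp only [mul_assoc, Units.mul_inv, mul_one]

lemma exists_conj_of_nonscalar (a b : GL (Fin 2) F)
    (ha : ¬ IsScalarMat (a : Matrix (Fin 2) (Fin 2) F))
    (hb : ¬ IsScalarMat (b : Matrix (Fin 2) (Fin 2) F))
    (hd : (a : Matrix (Fin 2) (Fin 2) F).det = (b : Matrix (Fin 2) (Fin 2) F).det)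
    (ht : (a : Matrix (Fin 2) (Fin 2) F).trace = (b : Matrix (Fin 2) (Fin 2) F).trace) :
    ∃ c : GL (Fin 2) F, c * a * c⁻¹ = b := by
  obtain ⟨x, y, hP⟩ := exists_krylov_det_ne_zero _ ha
  obtain ⟨x', y', hP'⟩ := exists_krylov_det_ne_zero _ hb
  refine ⟨GeneralLinearGroup.mkOfDetNeZero _ hP' * (GeneralLinearGroup.mkOfDetNeZero _ hP)⁻¹, ?_⟩
  rw [mul_inv_eq_iff_eq_mul]
  apply Units.ext
  have h := mul_krylov (b : Matrix (Fin 2) (Fin 2) F) x' y'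
  rw [← hd, ← ht] at h
  exact conj_of_krylov _ _ rfl rfl (mul_krylov _ x y) h

lemma det_krylov_ne_zero_of_eq (A B : Matrix (Fin 2) (Fin 2) F) (x y α β : F)
    (hv : x ≠ 0 ∨ y ≠ 0)
    (h0 : B 0 0 * x + B 0 1 * y = α * x + β * (A 0 0 * x + A 0 1 * y))
    (h1 : B 1 0 * x + B 1 1 * y = α * y + β * (A 1 0 * x + A 1 1 * y))
    (hc : (A * B - B * A).det ≠ 0) : (krylov A x y).det ≠ 0 := by
  intro h
  apply hc
  rw [← Matrix.exists_mulVec_eq_zero_iff]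
  refine ⟨![x, y], ?_, ?_⟩
  · intro hz
    have e0 := congrFun hz 0
    have e1 := congrFun hz 1
    simp at e0 e1
    tauto
  · have hμ : ∃ μ, A 0 0 * x + A 0 1 * y = μ * x ∧ A 1 0 * x + A 1 1 * y = μ * y := by
      simp only [krylov, Matrix.det_fin_two_of] at h
      rcases hv with hx | hy
      · refine ⟨(A 0 0 * x + A 0 1 * y) / x, by field_simp, ?_⟩
        field_simp
        linear_combination h
      · refine ⟨(A 1 0 * x + A 1 1 * y) / y, ?_, by field_simp⟩
        field_simp
        linear_combination -h
    obtain ⟨μ, m0, m1⟩ := hμ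
    rw [m0] at h0
    rw [m1] at h1
    ext i
    fin_cases i <;> simp [Matrix.mulVec, dotProduct, Fin.sum_univ_two, Matrix.mul_apply]
    · linear_combination A 0 0 * h0 + A 0 1 * h1 + (α + β * μ) * m0 - B 0 0 * m0 - B 0 1 * m1
        - μ * h0
    · linear_combination A 1 0 * h0 + A 1 1 * h1 + (α + β * μ) * m1 - B 1 0 * m0 - B 1 1 * m1
        - μ * h1

lemma det_commutator_eq (A B : Matrix (Fin 2) (Fin 2) F) :
    (A * B - B * A).det = 4 * A.det * B.det - A.trace ^ 2 * B.det - B.trace ^ 2 * A.det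
      - (A * B).trace ^ 2 + A.trace * B.trace * (A * B).trace := by
  simp [Matrix.det_fin_two, Matrix.trace_fin_two, Matrix.mul_apply, Fin.sum_univ_two]
  ring

lemma det_sub_smul_sub_smul (A B : Matrix (Fin 2) (Fin 2) F) (α β : F) :
    (B - α • (1 : Matrix (Fin 2) (Fin 2) F) - β • A).det = B.det + α ^ 2 + β ^ 2 * A.det
      - α * B.trace + α * β * A.trace - β * (A.trace * B.trace - (A * B).trace) := by
  simp [Matrix.det_fin_two, Matrix.trace_fin_two, Matrix.mul_apply, Fin.sum_univ_two]
  ring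

/-- A pair of matrices without a common eigenvector is determined up to simultaneous
conjugation by the traces and determinants of its members and the trace of their product. -/
lemma exists_conj_pair (a b a' b' : GL (Fin 2) F)
    (hda : (a : Matrix (Fin 2) (Fin 2) F).det = (a' : Matrix (Fin 2) (Fin 2) F).det)
    (hta : (a : Matrix (Fin 2) (Fin 2) F).trace = (a' : Matrix (Fin 2) (Fin 2) F).trace)
    (hdb : (b : Matrix (Fin 2) (Fin 2) F).det = (b' : Matrix (Fin 2) (Fin 2) F).det)
    (htb : (b : Matrix (Fin 2) (Fin 2) F).trace = (b' : Matrix (Fin 2) (Fin 2) F).trace)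
    (hab : ((a : Matrix (Fin 2) (Fin 2) F) * b).trace
      = ((a' : Matrix (Fin 2) (Fin 2) F) * b').trace)
    (ha : ¬ IsScalarMat (a : Matrix (Fin 2) (Fin 2) F))
    (hc : ((a : Matrix (Fin 2) (Fin 2) F) * b - b * a).det ≠ 0) :
    ∃ c : GL (Fin 2) F, c * a * c⁻¹ = a' ∧ c * b * c⁻¹ = b' := by
  obtain ⟨x, y, hP⟩ := exists_krylov_det_ne_zero _ ha
  set A := (a : Matrix (Fin 2) (Fin 2) F)
  set B := (b : Matrix (Fin 2) (Fin 2) F)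
  set A' := (a' : Matrix (Fin 2) (Fin 2) F)
  set B' := (b' : Matrix (Fin 2) (Fin 2) F)
  have hαβ : ∃ α β, B 0 0 * x + B 0 1 * y = α * x + β * (A 0 0 * x + A 0 1 * y) ∧
      B 1 0 * x + B 1 1 * y = α * y + β * (A 1 0 * x + A 1 1 * y) := by
    refine ⟨((krylov A x y)⁻¹ *ᵥ (B *ᵥ ![x, y])) 0, ((krylov A x y)⁻¹ *ᵥ (B *ᵥ ![x, y])) 1, ?_⟩
    have h : krylov A x y *ᵥ ((krylov A x y)⁻¹ *ᵥ (B *ᵥ ![x, y])) = B *ᵥ ![x, y] := by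
      rw [Matrix.mulVec_mulVec, Matrix.mul_nonsing_inv _ (by simpa using hP), Matrix.one_mulVec]
    generalize (krylov A x y)⁻¹ *ᵥ (B *ᵥ ![x, y]) = w at h
    have e0 := congrFun h 0
    have e1 := congrFun h 1
    simp [krylov, Matrix.mulVec, dotProduct, Fin.sum_univ_two] at e0 e1
    exact ⟨by linear_combination -e0, by linear_combination -e1⟩
  obtain ⟨α, β, h0, h1⟩ := hαβ
  have hz : (B' - α • (1 : Matrix (Fin 2) (Fin 2) F) - β • A').det = 0 := by
    rw [det_sub_smul_sub_smul, ← hda, ← hta, ← hdb, ← htb, ← hab, ← det_sub_smul_sub_smul,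
      ← Matrix.exists_mulVec_eq_zero_iff]
    refine ⟨![x, y], ?_, ?_⟩
    · intro hz
      have e0 := congrFun hz 0
      have e1 := congrFun hz 1
      simp at e0 e1
      apply hP
      simp [krylov, e0, e1, Matrix.det_fin_two]
    · ext i
      fin_cases i <;> simp [Matrix.mulVec, dotProduct, Fin.sum_univ_two]
      · linear_combination h0
      · linear_combination h1
  obtain ⟨w, hw, hw0⟩ := Matrix.exists_mulVec_eq_zero_iff.mpr hz
  have e0 := congrFun hw0 0
  have e1 := congrFun hw0 1
  simp [Matrix.mulVec, dotProduct, Fin.sum_univ_two] at e0 e1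
  have h0' : B' 0 0 * w 0 + B' 0 1 * w 1
      = α * w 0 + β * (A' 0 0 * w 0 + A' 0 1 * w 1) := by linear_combination e0
  have h1' : B' 1 0 * w 0 + B' 1 1 * w 1
      = α * w 1 + β * (A' 1 0 * w 0 + A' 1 1 * w 1) := by linear_combination e1
  have hw' : w 0 ≠ 0 ∨ w 1 ≠ 0 := by
    by_contra! hcon
    apply hw
    ext i
    fin_cases i
    · exact hcon.1
    · exact hcon.2
  have hP' : (krylov A' (w 0) (w 1)).det ≠ 0 := by
    apply det_krylov_ne_zero_of_eq A' B' _ _ α β hw' h0' h1'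
    rw [det_commutator_eq, ← hda, ← hta, ← hdb, ← htb, ← hab, ← det_commutator_eq]
    exact hc
  have k1 := mul_krylov A' (w 0) (w 1)
  have k2 := mul_krylov_of_eq A' B' (w 0) (w 1) α β h0' h1'
  rw [← hda, ← hta] at k1
  rw [← hda, ← hta, ← htb, ← hab] at k2
  refine ⟨GeneralLinearGroup.mkOfDetNeZero _ hP' * (GeneralLinearGroup.mkOfDetNeZero _ hP)⁻¹,
    ?_, ?_⟩
  · rw [mul_inv_eq_iff_eq_mul]
    exact Units.ext (conj_of_krylov _ _ rfl rfl (mul_krylov _ x y) k1)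
  · rw [mul_inv_eq_iff_eq_mul]
    exact Units.ext (conj_of_krylov _ _ rfl rfl (mul_krylov_of_eq A B x y α β h0 h1) k2)

/-- A matrix commuting with a nonscalar `A` is a linear polynomial in `A`. -/
lemma exists_eq_smul_add_smul {A X : Matrix (Fin 2) (Fin 2) F} (hA : ¬ IsScalarMat A)
    (h : X * A = A * X) : ∃ α β : F, X = α • (1 : Matrix (Fin 2) (Fin 2) F) + β • A := by
  have h00 := congrFun (congrFun h 0) 0
  have h01 := congrFun (congrFun h 0) 1
  have h10 := congrFun (congrFun h 1) 0
  simp [Matrix.mul_apply, Fin.sum_univ_two] at h00 h01 h10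
  by_cases hb : A 0 1 = 0
  · by_cases hcc : A 1 0 = 0
    · have hd : A 0 0 - A 1 1 ≠ 0 := fun h => hA ⟨hb, hcc, sub_eq_zero.mp h⟩
      have x01 : X 0 1 = 0 := by
        apply (mul_eq_zero.mp _).resolve_right hd
        rw [hb] at h01
        linear_combination -h01
      have x10 : X 1 0 = 0 := by
        apply (mul_eq_zero.mp _).resolve_right hd
        rw [hcc] at h10
        linear_combination h10
      refine ⟨X 0 0 - (X 0 0 - X 1 1) / (A 0 0 - A 1 1) * A 0 0,
        (X 0 0 - X 1 1) / (A 0 0 - A 1 1), ?_⟩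
      ext i j
      fin_cases i <;> fin_cases j <;> simp [hb, hcc, x01, x10]
      field_simp
      ring
    · refine ⟨X 0 0 - X 1 0 / A 1 0 * A 0 0, X 1 0 / A 1 0, ?_⟩
      ext i j
      fin_cases i <;> fin_cases j <;> simp [hcc]
      · field_simp
        linear_combination h00
      · field_simp
        linear_combination h10
  · refine ⟨X 0 0 - X 0 1 / A 0 1 * A 0 0, X 0 1 / A 0 1, ?_⟩
    ext i j
    fin_cases i <;> fin_cases j <;> simp [hb]
    · field_simp
      linear_combination -h00
    · field_simp
      linear_combination -h01

end MatrixLemmas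

section ClassEquation

/-- A group with a central subgroup `Z` outside of which commutation is transitive, and in which
the normalizer of the centralizer of any `x ∉ Z` exceeds that centralizer by index at most two. -/
structure IsTwistedCA {Γ : Type*} [Group Γ] (Z : Subgroup Γ) : Prop where
  central : ∀ z ∈ Z, ∀ g, Commute z g
  trans : ∀ x y w, y ∉ Z → Commute x y → Commute y w → Commute x w
  index_le : ∀ x, x ∉ Z → ∀ g h, Commute (g * x * g⁻¹) x → Commute (h * x * h⁻¹) x →
    ¬ Commute g x → ¬ Commute h x → Commute (g * h⁻¹) x

variable {Γ : Type*} [Group Γ] {Z : Subgroup Γ}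

/-- The elements outside `Z` some conjugate of which commutes with `x`. -/
def fusion (Z : Subgroup Γ) (x : Γ) : Set Γ := {y | y ∉ Z ∧ ∃ g, Commute (g * y * g⁻¹) x}

/-- The elements conjugating `x` to an element commuting with `x`. -/
def commNormalizer (x : Γ) : Set Γ := {g | Commute (g * x * g⁻¹) x}

lemma IsTwistedCA.conj_mem_iff (h : IsTwistedCA Z) (y g : Γ) : g * y * g⁻¹ ∈ Z ↔ y ∈ Z := by
  constructor
  · intro hy
    have := (h.central _ hy g⁻¹).eq
    rw [show g * y * g⁻¹ * g⁻¹ = g⁻¹ * (g * y * g⁻¹) from this] at *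
    have e : g⁻¹ * (g * y * g⁻¹) * g = y := by group
    rw [← e, ← (h.central _ hy g⁻¹).eq]
    simpa using hy
  · intro hy
    rw [← (h.central _ hy g).eq]
    simpa using hy

lemma commute_conj_iff (x y g : Γ) : Commute (g * x * g⁻¹) (g * y * g⁻¹) ↔ Commute x y := by
  simp only [Commute, SemiconjBy]
  constructor
  · intro h
    have := congrArg (fun u => g⁻¹ * u * g) h
    simpa [mul_assoc] using this
  · intro h
    have := congrArg (fun u => g * u * g⁻¹) h
    simpa [mul_assoc] using this

lemma IsTwistedCA.disjoint_fusion (h : IsTwistedCA Z) {x y : Γ}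
    (hxy : y ∉ fusion Z x) (hy : y ∉ Z) : Disjoint (fusion Z x) (fusion Z y) := by
  rw [Set.disjoint_left]
  rintro w ⟨hw, g, hg⟩ ⟨-, k, hk⟩
  apply hxy
  refine ⟨hy, g * k⁻¹, ?_⟩
  have e1 := (commute_conj_iff _ _ (g * k⁻¹)).mpr hk
  have e2 : g * k⁻¹ * (k * w * k⁻¹) * (g * k⁻¹)⁻¹ = g * w * g⁻¹ := by group
  rw [e2] at e1
  exact h.trans _ (g * w * g⁻¹) _ (by rwa [h.conj_mem_iff]) e1.symm hg

lemma IsTwistedCA.card_eq_of_mem_fusion (h : IsTwistedCA Z) {x y : Γ} (hx : x ∉ Z)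
    (hy : y ∈ fusion Z x) : {w | Commute w y}.ncard = {w | Commute w x}.ncard := by
  obtain ⟨hyZ, g, hg⟩ := hy
  refine Set.ncard_congr (fun w _ => g * w * g⁻¹) ?_ ?_ ?_
  · intro w hw
    exact h.trans _ (g * y * g⁻¹) _ (by rwa [h.conj_mem_iff])
      ((commute_conj_iff _ _ _).mpr hw) hg
  · intro a b _ _ hab
    simpa using hab
  · intro b hb
    refine ⟨g⁻¹ * b * g, ?_, by group⟩
    have : Commute b (g * y * g⁻¹) := h.trans _ x _ hx hb hg.symm
    have e : b = g * (g⁻¹ * b * g) * g⁻¹ := by group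
    rw [e, commute_conj_iff] at this
    exact this

variable [Finite Γ]

lemma IsTwistedCA.card_fusion_mul (h : IsTwistedCA Z) {x : Γ} (hx : x ∉ Z) :
    (fusion Z x).ncard * (commNormalizer x).ncard
      = Nat.card Γ * ({y | Commute y x}.ncard - Nat.card Z) := by
  classical
  cases nonempty_fintype Γ
  have key := Finset.sum_card_bipartiteAbove_eq_sum_card_bipartiteBelow
    (s := (Finset.univ : Finset Γ)) (t := (Finset.univ : Finset Γ))
    (fun g y => y ∉ Z ∧ Commute (g * y * g⁻¹) x)
  have h1 : ∀ g : Γ, (Finset.bipartiteAbove (fun g y => y ∉ Z ∧ Commute (g * y * g⁻¹) x)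
      Finset.univ g).card = {y | Commute y x}.ncard - Nat.card Z := by
    intro g
    have hsub : (Z : Set Γ) ⊆ {y | Commute y x} := fun z hz => h.central z hz x
    rw [show Nat.card Z = (Z : Set Γ).ncard from rfl, ← Set.ncard_sdiff hsub,
      ← Set.ncard_coe_finset]
    refine Set.ncard_congr (fun y _ => g * y * g⁻¹) ?_ ?_ ?_
    · intro y hy
      simp [Finset.bipartiteAbove] at hy
      exact ⟨hy.2, fun hz => hy.1 ((h.conj_mem_iff y g).mp hz)⟩
    · intro a b _ _ hab
      simpa using hab
    · intro b hb
      refine ⟨g⁻¹ * b * g, ?_, by group⟩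
      have e : g * (g⁻¹ * b * g) * g⁻¹ = b := by group
      simp only [Finset.bipartiteAbove, Finset.coe_filter, Finset.mem_univ, true_and,
        Set.mem_ofPred_eq, e]
      refine ⟨fun hz => hb.2 ?_, hb.1⟩
      rw [← h.conj_mem_iff _ g, e] at hz
      exact hz
  have h2 : ∀ y : Γ, (Finset.bipartiteBelow (fun g y => y ∉ Z ∧ Commute (g * y * g⁻¹) x)
      Finset.univ y).card = if y ∈ fusion Z x then (commNormalizer x).ncard else 0 := by
    intro y
    split_ifs with hy
    · obtain ⟨hyZ, g0, hg0⟩ := hy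
      rw [← Set.ncard_coe_finset]
      refine Set.ncard_congr (fun g _ => g * g0⁻¹) ?_ ?_ ?_
      · intro g hg
        simp [Finset.bipartiteBelow] at hg
        have e1 : Commute (g * g0⁻¹ * (g0 * y * g0⁻¹) * (g * g0⁻¹)⁻¹)
            (g * g0⁻¹ * x * (g * g0⁻¹)⁻¹) := (commute_conj_iff _ _ _).mpr hg0
        have e2 : g * g0⁻¹ * (g0 * y * g0⁻¹) * (g * g0⁻¹)⁻¹ = g * y * g⁻¹ := by group
        rw [e2] at e1
        exact h.trans _ (g * y * g⁻¹) _ (by rwa [h.conj_mem_iff]) e1.symm hg.2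
      · intro a b _ _ hab
        simpa using hab
      · intro b hb
        refine ⟨b * g0, ?_, by group⟩
        simp only [Finset.bipartiteBelow, Finset.coe_filter, Finset.mem_univ, true_and,
          Set.mem_ofPred_eq]
        refine ⟨hyZ, ?_⟩
        have e1 : Commute (b * (g0 * y * g0⁻¹) * b⁻¹) (b * x * b⁻¹) :=
          (commute_conj_iff _ _ _).mpr hg0
        have e2 : b * g0 * y * (b * g0)⁻¹ = b * (g0 * y * g0⁻¹) * b⁻¹ := by group
        rw [e2]
        exact h.trans _ (b * x * b⁻¹) _ (by rwa [h.conj_mem_iff]) e1 hb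
    · rw [Finset.card_eq_zero, Finset.bipartiteBelow, Finset.filter_eq_empty_iff]
      intro g _ hg
      exact hy ⟨hg.1, g, hg.2⟩
  simp only [h1, h2] at key
  rw [Finset.sum_const, ← Finset.sum_filter, Finset.sum_const, Finset.card_univ] at key
  simp only [smul_eq_mul] at key
  rw [Nat.card_eq_fintype_card, key, ← Set.ncard_coe_finset]
  simp

lemma IsTwistedCA.card_commNormalizer (h : IsTwistedCA Z) {x : Γ} (hx : x ∉ Z) :
    (commNormalizer x).ncard = {y | Commute y x}.ncard ∨
      (commNormalizer x).ncard = 2 * {y | Commute y x}.ncard := by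
  have hsub : {y | Commute y x} ⊆ commNormalizer x := by
    intro y hy
    have : y * x * y⁻¹ = x := by rw [(show Commute y x from hy).eq]; simp
    simp [commNormalizer, this]
  by_cases hex : ∃ g0 ∈ commNormalizer x, ¬ Commute g0 x
  · right
    obtain ⟨g0, hg0, hn⟩ := hex
    have hu : commNormalizer x = {y | Commute y x} ∪ (fun y => y * g0) '' {y | Commute y x} := by
      ext g
      constructor
      · intro hg
        by_cases hc : Commute g x
        · exact Or.inl hc
        · exact Or.inr ⟨g * g0⁻¹, h.index_le x hx g g0 hg hg0 hc hn, by simp⟩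
      · rintro (hg | ⟨y, hy, rfl⟩)
        · exact hsub hg
        · have c1 : Commute y (g0 * x * g0⁻¹) := h.trans _ x _ hx hy (Commute.symm hg0)
          have e : y * g0 * x * (y * g0)⁻¹ = g0 * x * g0⁻¹ := by
            have : y * g0 * x * (y * g0)⁻¹ = y * (g0 * x * g0⁻¹) * y⁻¹ := by group
            rw [this, c1.eq]; simp
          simp only [commNormalizer, Set.mem_ofPred_eq, e]
          exact hg0
    rw [hu, Set.ncard_union_eq, Set.ncard_image_of_injective _ (mul_left_injective g0), two_mul]
    rw [Set.disjoint_left]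
    rintro _ h1 ⟨y, hy, rfl⟩
    apply hn
    have := (Commute.inv_left (show Commute y x from hy)).mul_left (show Commute (y * g0) x from h1)
    simpa using this
  · left
    push Not at hex
    congr 1
    exact Set.Subset.antisymm (fun g hg => hex g hg) hsub

lemma IsTwistedCA.exists_params (h : IsTwistedCA Z) {N : ℕ} (hN : Nat.card Γ = Nat.card Z * N)
    {x : Γ} (hx : x ∉ Z) : ∃ n f : ℕ, {y | Commute y x}.ncard = Nat.card Z * n ∧ 2 ≤ n ∧
      (f = 1 ∨ f = 2) ∧ f * n ≤ N ∧
      ((fusion Z x).ncard / Nat.card Z : ℚ) * (f * n) = N * (n - 1) := by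
  have hz : 0 < Nat.card Z := Nat.card_pos
  let C : Subgroup Γ := Subgroup.centralizer {x}
  have hC : (C : Set Γ) = {y | Commute y x} := by
    ext y
    simp [C, Subgroup.mem_centralizer_singleton_iff, Commute, SemiconjBy]
  have hCc : Nat.card C = {y | Commute y x}.ncard := by rw [← hC]; rfl
  have hle : Z ≤ C := fun z hz => by
    rw [← SetLike.mem_coe, hC]; exact h.central z hz x
  obtain ⟨n, hn⟩ := Subgroup.card_dvd_of_le hle
  rw [hCc] at hn
  obtain ⟨f, hf, hfN⟩ : ∃ f, (f = 1 ∨ f = 2) ∧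
      (commNormalizer x).ncard = f * (Nat.card Z * n) := by
    rcases h.card_commNormalizer hx with e | e
    · exact ⟨1, Or.inl rfl, by rw [e, hn, one_mul]⟩
    · exact ⟨2, Or.inr rfl, by rw [e, hn]⟩
  have hlt : Nat.card Z < {y | Commute y x}.ncard := by
    rw [← hC]
    refine Set.ncard_lt_ncard (s := (Z : Set Γ)) ⟨hle, fun hh => hx (hh ?_)⟩
    rw [hC]
    exact Commute.refl x
  have hn2 : 2 ≤ n := by
    by_contra! hcon
    interval_cases n <;> omega
  have hcard := h.card_fusion_mul hx
  rw [hfN, hn, hN] at hcard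
  refine ⟨n, f, hn, hn2, hf, ?_, ?_⟩
  · have : (commNormalizer x).ncard ≤ Nat.card Γ := by
      rw [← Set.ncard_univ]
      exact Set.ncard_le_ncard (Set.subset_univ _)
    rw [hfN, hN] at this
    apply Nat.le_of_mul_le_mul_left _ hz
    calc _ = f * (Nat.card Z * n) := by ring
      _ ≤ _ := this
  · have e : Nat.card Z * n - Nat.card Z = Nat.card Z * (n - 1) := by
      rw [Nat.mul_sub, mul_one]
    rw [e] at hcard
    have hq := congrArg (Nat.cast (R := ℚ)) hcard
    push_cast [Nat.cast_sub (show 1 ≤ n by omega)] at hq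
    have hz' : (Nat.card Z : ℚ) ≠ 0 := by positivity
    field_simp
    apply mul_left_cancel₀ hz'
    linear_combination hq

lemma quarter_le {N n f : ℕ} {κ : ℚ} (hn : 2 ≤ n) (hf : f = 1 ∨ f = 2)
    (hκ : κ * (f * n) = N * (n - 1)) : (N : ℚ) / 4 ≤ κ := by
  have hn' : (2 : ℚ) ≤ n := by exact_mod_cast hn
  have hN : (0 : ℚ) ≤ N := by positivity
  rcases hf with rfl | rfl <;> push_cast at hκ
  · by_contra! hlt
    nlinarith [mul_nonneg hN (sub_nonneg.mpr hn')]
  · by_contra! hlt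
    nlinarith [mul_nonneg hN (sub_nonneg.mpr hn')]

lemma exists_div_eq {N n f : ℕ} {κ : ℚ} (hn : 2 ≤ n)
    (hκ : κ * (f * n) = N * (n - 1)) : ∃ y : ℚ, 0 ≤ y ∧ y * n = N ∧ f * κ = N - y ∧
      ∀ k : ℕ, k ≤ n → y * k ≤ N := by
  have hn' : (2 : ℚ) ≤ n := by exact_mod_cast hn
  have hn0 : (n : ℚ) ≠ 0 := by linarith
  have e : (N : ℚ) / n * n = N := by field_simp
  refine ⟨N / n, by positivity, e, ?_, ?_⟩
  · field_simp
    linear_combination hκ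
  · intro k hk
    have hk' : (k : ℚ) ≤ n := by exact_mod_cast hk
    calc (N : ℚ) / n * k ≤ N / n * n := by gcongr
      _ = N := e

lemma one_class {N n f : ℕ} {κ : ℚ} (hn : 2 ≤ n) (hf : f = 1 ∨ f = 2) (hfN : f * n ≤ N)
    (hκ : κ * (f * n) = N * (n - 1)) (hs : κ = N - 1) : N = n := by
  have hn' : (2 : ℚ) ≤ n := by exact_mod_cast hn
  have hfN' : (f * n : ℚ) ≤ N := by exact_mod_cast hfN
  subst hs
  rcases hf with rfl | rfl <;> push_cast at hκ hfN'
  · have : (N : ℚ) = n := by linarith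
    exact_mod_cast this
  · exfalso
    nlinarith

lemma two_classes {N n₁ n₂ f₁ f₂ : ℕ} {κ₁ κ₂ : ℚ} (h21 : n₂ ≤ n₁) (hn₂ : 2 ≤ n₂)
    (hf₁ : f₁ = 1 ∨ f₁ = 2) (hf₂ : f₂ = 1 ∨ f₂ = 2)
    (hN₁ : f₁ * n₁ ≤ N) (hN₂ : f₂ * n₂ ≤ N)
    (hκ₁ : κ₁ * (f₁ * n₁) = N * (n₁ - 1)) (hκ₂ : κ₂ * (f₂ * n₂) = N * (n₂ - 1))
    (hs : κ₁ + κ₂ = N - 1) : N = 2 * n₁ ∨ (n₁ = 3 ∧ N = 12) := by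
  obtain ⟨y₁, p₁, e₁, k₁, b₁⟩ := exists_div_eq (le_trans hn₂ h21) hκ₁
  obtain ⟨y₂, p₂, e₂, k₂, b₂⟩ := exists_div_eq hn₂ hκ₂
  have hpos : (0 : ℚ) < N := by
    have : 0 < f₂ * n₂ := by rcases hf₂ with rfl | rfl <;> omega
    exact_mod_cast lt_of_lt_of_le this hN₂
  have c₁ := b₁ 2 (by omega)
  have c₂ := b₂ 2 (by omega)
  have hN₁' : (f₁ * n₁ : ℚ) ≤ N := by exact_mod_cast hN₁
  have hN₂' : (f₂ * n₂ : ℚ) ≤ N := by exact_mod_cast hN₂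
  have m₁ : (f₁ : ℚ) ≤ y₁ := by
    have : (0 : ℚ) < n₁ := by exact_mod_cast (by omega : 0 < n₁)
    rw [← e₁] at hN₁'
    exact le_of_mul_le_mul_right hN₁' this
  have m₂ : (f₂ : ℚ) ≤ y₂ := by
    have : (0 : ℚ) < n₂ := by exact_mod_cast (by omega : 0 < n₂)
    rw [← e₂] at hN₂'
    exact le_of_mul_le_mul_right hN₂' this
  rcases hf₁ with rfl | rfl <;> rcases hf₂ with rfl | rfl <;> push_cast at *
  · exfalso
    linarith
  · -- the first class has self-normalizing centralizers
    have hsum : 2 * y₁ + y₂ = N + 2 := by linarith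
    by_cases h4 : 4 ≤ n₁
    · have := b₁ 4 h4
      push_cast at this
      by_cases h3 : 3 ≤ n₂
      all_goals exfalso
      all_goals linarith
    · by_cases h3 : n₁ = 3
      · subst h3
        by_cases h3' : n₂ = 3
        · subst h3'
          exfalso
          push_cast at *
          linarith
        · obtain rfl : n₂ = 2 := by omega
          right
          refine ⟨rfl, ?_⟩
          push_cast at *
          have : (N : ℚ) = 12 := by linarith
          exact_mod_cast this
      · obtain rfl : n₁ = 2 := by omega
        obtain rfl : n₂ = 2 := by omega
        left
        push_cast at *
        have : (N : ℚ) = 4 := by linarith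
        exact_mod_cast this
  · have hsum : y₁ + 2 * y₂ = N + 2 := by linarith
    by_cases h4 : 4 ≤ n₂
    · have := b₁ 4 (by omega)
      have := b₂ 4 h4
      push_cast at *
      exfalso
      linarith
    · by_cases h3 : n₂ = 3
      · subst h3
        have := b₁ 3 h21
        push_cast at *
        exfalso
        linarith
      · obtain rfl : n₂ = 2 := by omega
        left
        push_cast at *
        have hy : y₁ = 2 := by linarith
        subst hy
        exact_mod_cast e₁.symm
  · exfalso
    linarith

lemma three_classes {N n₁ n₂ n₃ f₁ f₂ f₃ : ℕ} {κ₁ κ₂ κ₃ : ℚ} (h21 : n₂ ≤ n₁) (h32 : n₃ ≤ n₂)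
    (hn₃ : 2 ≤ n₃) (hf₁ : f₁ = 1 ∨ f₁ = 2) (hf₂ : f₂ = 1 ∨ f₂ = 2) (hf₃ : f₃ = 1 ∨ f₃ = 2)
    (hκ₁ : κ₁ * (f₁ * n₁) = N * (n₁ - 1)) (hκ₂ : κ₂ * (f₂ * n₂) = N * (n₂ - 1))
    (hκ₃ : κ₃ * (f₃ * n₃) = N * (n₃ - 1))
    (hs : κ₁ + κ₂ + κ₃ = N - 1) : N = 2 * n₁ ∨ (n₁ = 3 ∧ N = 12) ∨ (n₁ = 4 ∧ N = 24) ∨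
      (n₁ = 5 ∧ N = 60 ∧ n₂ = 3 ∧ n₃ = 2) := by
  obtain ⟨y₁, p₁, e₁, k₁, b₁⟩ := exists_div_eq (by omega) hκ₁
  obtain ⟨y₂, p₂, e₂, k₂, b₂⟩ := exists_div_eq (by omega) hκ₂
  obtain ⟨y₃, p₃, e₃, k₃, b₃⟩ := exists_div_eq hn₃ hκ₃
  have c₁ := b₁ 2 (by omega)
  have c₂ := b₂ 2 (by omega)
  have c₃ := b₃ 2 (by omega)
  have hsum : f₁ = 2 ∧ f₂ = 2 ∧ f₃ = 2 := by
    rcases hf₁ with rfl | rfl <;> rcases hf₂ with rfl | rfl <;> rcases hf₃ with rfl | rfl <;>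
      first | exact ⟨rfl, rfl, rfl⟩ | (exfalso; push_cast at *; linarith)
  obtain ⟨rfl, rfl, rfl⟩ := hsum
  push_cast at *
  have hsum : y₁ + y₂ + y₃ = N + 2 := by linarith
  have hn3 : n₃ = 2 := by
    by_contra hne
    have := b₁ 3 (by omega)
    have := b₂ 3 (by omega)
    have := b₃ 3 (by omega)
    push_cast at *
    linarith
  subst hn3
  have hn2 : n₂ ≤ 3 := by
    by_contra hne
    have := b₁ 4 (by omega)
    have := b₂ 4 (by omega)
    push_cast at *
    linarith
  by_cases hn22 : n₂ = 2
  · subst hn22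
    left
    push_cast at *
    have hy : y₁ = 2 := by linarith
    subst hy
    exact_mod_cast e₁.symm
  · obtain rfl : n₂ = 3 := by omega
    have hn1 : n₁ ≤ 5 := by
      by_contra hne
      have := b₁ 6 (by omega)
      push_cast at *
      linarith
    right
    interval_cases n₁ <;> push_cast at e₁ e₂ e₃
    · have : (N : ℚ) = 12 := by linarith
      exact Or.inl ⟨rfl, by exact_mod_cast this⟩
    · have : (N : ℚ) = 24 := by linarith
      exact Or.inr (Or.inl ⟨rfl, by exact_mod_cast this⟩)
    · have : (N : ℚ) = 60 := by linarith
      exact Or.inr (Or.inr ⟨rfl, by exact_mod_cast this, rfl, rfl⟩)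

/-- The possible orders of a group whose largest centralizer of an element outside `Z` has
`n` times as many elements as `Z`. -/
theorem IsTwistedCA.card_cases (h : IsTwistedCA Z) {x : Γ} (hx : x ∉ Z)
    (hmax : ∀ y ∉ Z, {w | Commute w y}.ncard ≤ {w | Commute w x}.ncard) :
    ∃ n, 2 ≤ n ∧ {w | Commute w x}.ncard = Nat.card Z * n ∧
      (Nat.card Γ = Nat.card Z * n ∨ Nat.card Γ = Nat.card Z * (2 * n) ∨
        (n = 3 ∧ Nat.card Γ = Nat.card Z * 12) ∨ (n = 4 ∧ Nat.card Γ = Nat.card Z * 24) ∨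
        (n = 5 ∧ Nat.card Γ = Nat.card Z * 60 ∧ ∀ y ∉ Z, {w | Commute w y}.ncard = Nat.card Z * 5 ∨
          {w | Commute w y}.ncard = Nat.card Z * 3 ∨
            {w | Commute w y}.ncard = Nat.card Z * 2)) := by
  obtain ⟨N, hN⟩ := Subgroup.card_subgroup_dvd_card Z
  have hz : 0 < Nat.card Z := Nat.card_pos
  have hz' : (Nat.card Z : ℚ) ≠ 0 := by positivity
  have hNpos : 0 < N := by
    rcases Nat.eq_zero_or_pos N with rfl | h0
    · have : 0 < Nat.card Γ := Nat.card_pos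
      omega
    · exact h0
  have htot : ((Zᶜ : Set Γ).ncard / Nat.card Z : ℚ) = N - 1 := by
    have := Set.ncard_add_ncard_compl (Z : Set Γ)
    rw [hN, show (Z : Set Γ).ncard = Nat.card Z from rfl] at this
    have hq := congrArg (Nat.cast (R := ℚ)) this
    push_cast at hq
    field_simp
    linear_combination hq
  have hsubZ : ∀ y, fusion Z y ⊆ (Zᶜ : Set Γ) := fun y w hw => hw.1
  have hself : ∀ y ∉ Z, y ∈ fusion Z y := fun y hy => ⟨hy, 1, by simp⟩
  obtain ⟨n₁, f₁, hc₁, hn₁, hf₁, hN₁, hκ₁⟩ := h.exists_params hN hx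
  have hle : ∀ {y n}, y ∉ Z → {w | Commute w y}.ncard = Nat.card Z * n → n ≤ n₁ := by
    intro y n hy hyn
    have := hmax y hy
    rw [hc₁, hyn] at this
    exact Nat.le_of_mul_le_mul_left this hz
  refine ⟨n₁, hn₁, hc₁, ?_⟩
  rw [hN]
  by_cases hA : fusion Z x = (Zᶜ : Set Γ)
  · rw [hA, htot] at hκ₁
    left
    rw [one_class hn₁ hf₁ hN₁ hκ₁ rfl]
  obtain ⟨x₂, hx₂, hx₂f⟩ := Set.exists_of_ssubset ((hsubZ x).ssubset_of_ne hA)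
  have d12 := h.disjoint_fusion hx₂f hx₂
  obtain ⟨n₂, f₂, hc₂, hn₂, hf₂, hN₂, hκ₂⟩ := h.exists_params hN hx₂
  by_cases hB : fusion Z x ∪ fusion Z x₂ = (Zᶜ : Set Γ)
  · rw [← hB, Set.ncard_union_eq d12] at htot
    push_cast at htot
    rw [add_div] at htot
    rcases two_classes (hle hx₂ hc₂) hn₂ hf₁ hf₂ hN₁ hN₂ hκ₁ hκ₂ htot with e | ⟨e, e'⟩
    · exact Or.inr (Or.inl (by rw [e]))
    · exact Or.inr (Or.inr (Or.inl ⟨e, by rw [e']⟩))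
  obtain ⟨x₃, hx₃, hx₃f⟩ := Set.exists_of_ssubset
    ((Set.union_subset (hsubZ x) (hsubZ x₂)).ssubset_of_ne hB)
  simp only [Set.mem_union, not_or] at hx₃f
  have d13 := h.disjoint_fusion hx₃f.1 hx₃
  have d23 := h.disjoint_fusion hx₃f.2 hx₃
  obtain ⟨n₃, f₃, hc₃, hn₃, hf₃, hN₃, hκ₃⟩ := h.exists_params hN hx₃
  by_cases hC : fusion Z x ∪ fusion Z x₂ ∪ fusion Z x₃ = (Zᶜ : Set Γ)
  · have htot' := htot
    rw [← hC, Set.ncard_union_eq (Set.disjoint_union_left.mpr ⟨d13, d23⟩),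
      Set.ncard_union_eq d12] at htot
    push_cast at htot
    rw [add_div, add_div] at htot
    have hall : ∀ y ∉ Z, {w | Commute w y}.ncard = Nat.card Z * n₁ ∨
        {w | Commute w y}.ncard = Nat.card Z * n₂ ∨
        {w | Commute w y}.ncard = Nat.card Z * n₃ := by
      intro y hy
      have hy' : y ∈ fusion Z x ∪ fusion Z x₂ ∪ fusion Z x₃ := by rw [hC]; exact hy
      rcases hy' with (hy' | hy') | hy'
      · exact Or.inl (by rw [h.card_eq_of_mem_fusion hx hy', hc₁])
      · exact Or.inr (Or.inl (by rw [h.card_eq_of_mem_fusion hx₂ hy', hc₂]))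
      · exact Or.inr (Or.inr (by rw [h.card_eq_of_mem_fusion hx₃ hy', hc₃]))
    rcases le_total n₃ n₂ with h32 | h32
    · rcases three_classes (hle hx₂ hc₂) h32 hn₃ hf₁ hf₂ hf₃ hκ₁ hκ₂ hκ₃ htot with
        e | ⟨e, e'⟩ | ⟨e, e'⟩ | ⟨e, e', e2, e3⟩
      · exact Or.inr (Or.inl (by rw [e]))
      · exact Or.inr (Or.inr (Or.inl ⟨e, by rw [e']⟩))
      · exact Or.inr (Or.inr (Or.inr (Or.inl ⟨e, by rw [e']⟩)))
      · subst e e' e2 e3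
        exact Or.inr (Or.inr (Or.inr (Or.inr ⟨rfl, rfl, hall⟩)))
    · rcases three_classes (hle hx₃ hc₃) h32 hn₂ hf₁ hf₃ hf₂ hκ₁ hκ₃ hκ₂ (by linarith) with
        e | ⟨e, e'⟩ | ⟨e, e'⟩ | ⟨e, e', e2, e3⟩
      · exact Or.inr (Or.inl (by rw [e]))
      · exact Or.inr (Or.inr (Or.inl ⟨e, by rw [e']⟩))
      · exact Or.inr (Or.inr (Or.inr (Or.inl ⟨e, by rw [e']⟩)))
      · subst e e' e2 e3
        exact Or.inr (Or.inr (Or.inr (Or.inr ⟨rfl, rfl, fun y hy => by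
          have := hall y hy; tauto⟩)))
  exfalso
  obtain ⟨x₄, hx₄, hx₄f⟩ := Set.exists_of_ssubset
    ((Set.union_subset (Set.union_subset (hsubZ x) (hsubZ x₂)) (hsubZ x₃)).ssubset_of_ne hC)
  simp only [Set.mem_union, not_or] at hx₄f
  have d14 := h.disjoint_fusion hx₄f.1.1 hx₄
  have d24 := h.disjoint_fusion hx₄f.1.2 hx₄
  have d34 := h.disjoint_fusion hx₄f.2 hx₄
  obtain ⟨n₄, f₄, hc₄, hn₄, hf₄, hN₄, hκ₄⟩ := h.exists_params hN hx₄
  have hsub : fusion Z x ∪ fusion Z x₂ ∪ fusion Z x₃ ∪ fusion Z x₄ ⊆ (Zᶜ : Set Γ) :=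
    Set.union_subset (Set.union_subset (Set.union_subset (hsubZ x) (hsubZ x₂)) (hsubZ x₃))
      (hsubZ x₄)
  have hcle := Set.ncard_le_ncard hsub
  rw [Set.ncard_union_eq
      (Set.disjoint_union_left.mpr ⟨Set.disjoint_union_left.mpr ⟨d14, d24⟩, d34⟩),
    Set.ncard_union_eq (Set.disjoint_union_left.mpr ⟨d13, d23⟩), Set.ncard_union_eq d12] at hcle
  have hq : (((fusion Z x).ncard + (fusion Z x₂).ncard + (fusion Z x₃).ncard
      + (fusion Z x₄).ncard : ℕ) : ℚ) / Nat.card Z ≤ (Zᶜ : Set Γ).ncard / Nat.card Z := by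
    gcongr
  rw [htot] at hq
  push_cast at hq
  rw [add_div, add_div, add_div] at hq
  have q₁ := quarter_le hn₁ hf₁ hκ₁
  have q₂ := quarter_le hn₂ hf₂ hκ₂
  have q₃ := quarter_le hn₃ hf₃ hκ₃
  have q₄ := quarter_le hn₄ hf₄ hκ₄
  linarith

end ClassEquation

section SeparableGroups

variable {F : Type*} [Field F]

lemma mem_center_iff_isScalarMat (g : GL (Fin 2) F) :
    g ∈ Subgroup.center (GL (Fin 2) F) ↔ IsScalarMat g.val := by
  rw [Subgroup.mem_center_iff]
  constructor
  · intro h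
    have h1 : !![1, 1; 0, 1] * g.val = g.val * !![1, 1; 0, 1] := congrArg Units.val
      (h (GeneralLinearGroup.mkOfDetNeZero !![1, 1; 0, 1] (by simp)))
    have h2 : !![1, 0; 1, 1] * g.val = g.val * !![1, 0; 1, 1] := congrArg Units.val
      (h (GeneralLinearGroup.mkOfDetNeZero !![1, 0; 1, 1] (by simp)))
    have a := congrFun (congrFun h1 0) 0
    have b := congrFun (congrFun h1 0) 1
    have c := congrFun (congrFun h2 0) 0
    simp [Matrix.mul_apply, Fin.sum_univ_two] at a b c
    exact ⟨c, a, by linear_combination -b⟩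
  · rintro ⟨h1, h2, h3⟩ k
    apply Units.ext
    ext i j
    fin_cases i <;> fin_cases j <;> simp [Matrix.mul_apply, Fin.sum_univ_two, h1, h2, h3, mul_comm]

lemma val_eq_of_commute {x y : GL (Fin 2) F} (hx : x ∉ Subgroup.center (GL (Fin 2) F))
    (h : Commute y x) :
    ∃ α β : F, y.val = α • (1 : Matrix (Fin 2) (Fin 2) F) + β • x.val := by
  rw [mem_center_iff_isScalarMat] at hx
  exact exists_eq_smul_add_smul hx (congrArg Units.val h.eq)

lemma commute_of_commute_noncentral {x y w : GL (Fin 2) F}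
    (hy : y ∉ Subgroup.center (GL (Fin 2) F)) (h1 : Commute x y) (h2 : Commute y w) :
    Commute x w := by
  obtain ⟨α, β, e⟩ := val_eq_of_commute hy h1
  apply Units.ext
  have h := congrArg Units.val h2.eq
  simp only [Units.val_mul] at h ⊢
  rw [e, add_mul, mul_add, smul_mul_assoc, smul_mul_assoc, h]
  simp

lemma det_smul_one_add_smul (A : Matrix (Fin 2) (Fin 2) F) (α β : F) :
    (α • (1 : Matrix (Fin 2) (Fin 2) F) + β • A).det
      = α ^ 2 + α * β * A.trace + β ^ 2 * A.det := by
  simp [Matrix.det_fin_two, Matrix.trace_fin_two]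
  ring

lemma trace_smul_one_add_smul (A : Matrix (Fin 2) (Fin 2) F) (α β : F) :
    (α • (1 : Matrix (Fin 2) (Fin 2) F) + β • A).trace = 2 * α + β * A.trace := by
  simp [Matrix.trace_fin_two]
  ring

lemma trace_conj_val (g x : GL (Fin 2) F) : (g * x * g⁻¹).val.trace = x.val.trace := by
  rw [Units.val_mul, Matrix.trace_mul_comm, ← Units.val_mul]
  simp

lemma det_conj_val (g x : GL (Fin 2) F) : (g * x * g⁻¹).val.det = x.val.det := by
  rw [Units.val_mul, Matrix.det_mul_comm, ← Units.val_mul]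
  simp

lemma conj_eq_of_commute {g x : GL (Fin 2) F}
    (hx : x.val.trace ^ 2 ≠ 4 * x.val.det) (hxc : x ∉ Subgroup.center (GL (Fin 2) F))
    (h : Commute (g * x * g⁻¹) x) (hg : ¬ Commute g x) :
    (g * x * g⁻¹).val = x.val.trace • (1 : Matrix (Fin 2) (Fin 2) F) - x.val := by
  obtain ⟨α, β, e⟩ := val_eq_of_commute hxc h
  have ht := trace_conj_val g x
  have hd := det_conj_val g x
  rw [e, trace_smul_one_add_smul] at ht
  rw [e, det_smul_one_add_smul] at hd
  set t := x.val.trace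
  set d := x.val.det
  have hne : ¬ (α = 0 ∧ β = 1) := by
    rintro ⟨rfl, rfl⟩
    apply hg
    have : g * x * g⁻¹ = x := Units.ext (by simpa using e)
    exact mul_inv_eq_iff_eq_mul.mp this
  have hβ : (β - 1) * (β + 1) = 0 := by
    apply (mul_eq_zero.mp _).resolve_right (sub_ne_zero.mpr hx)
    linear_combination (2 * α + β * t + t) * ht - 4 * hd
  have hfin : α = t ∧ β = -1 := by
    by_cases h2 : (2 : F) = 0
    · have hb : β = 1 := by
        rcases mul_eq_zero.mp hβ with hb | hb
        · linear_combination hb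
        · linear_combination hb - h2
      subst hb
      have : α * (α + t) = 0 := by linear_combination hd
      rcases mul_eq_zero.mp this with ha | ha
      · exact absurd ⟨ha, rfl⟩ hne
      · exact ⟨by linear_combination ha - t * h2, by linear_combination h2⟩
    · rcases mul_eq_zero.mp hβ with hb | hb
      · have hb : β = 1 := by linear_combination hb
        subst hb
        have : 2 * α = 0 := by linear_combination ht
        exact absurd ⟨(mul_eq_zero.mp this).resolve_left h2, rfl⟩ hne
      · have hb : β = -1 := by linear_combination hb
        subst hb
        have : 2 * (α - t) = 0 := by linear_combination ht
        exact ⟨sub_eq_zero.mp ((mul_eq_zero.mp this).resolve_left h2), rfl⟩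
  rw [e, hfin.1, hfin.2]
  simp [sub_eq_add_neg]

lemma conj_conj_eq_of_commute {g x : GL (Fin 2) F}
    (h : (g * x * g⁻¹).val = x.val.trace • (1 : Matrix (Fin 2) (Fin 2) F) - x.val) :
    g * (g * x * g⁻¹) * g⁻¹ = x := by
  apply Units.ext
  have h1 : (g * (g * x * g⁻¹) * g⁻¹).val = g.val * (g * x * g⁻¹).val * (g⁻¹).val := by simp
  have h2 : g.val * x.val * (g⁻¹).val = (g * x * g⁻¹).val := by simp
  rw [h1, h, mul_sub, sub_mul, h2, h]
  simp

/-- Every element of `G` whose characteristic polynomial has a double root is scalar. -/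
def IsSeparableGroup (G : Subgroup (GL (Fin 2) F)) : Prop :=
  ∀ g ∈ G, g.val.trace ^ 2 = 4 * g.val.det → g ∈ Subgroup.center (GL (Fin 2) F)

lemma IsSeparableGroup.isTwistedCA {G : Subgroup (GL (Fin 2) F)} (hG : IsSeparableGroup G) :
    IsTwistedCA ((Subgroup.center (GL (Fin 2) F)).subgroupOf G) := by
  have hcoe : ∀ a b : G, Commute a b ↔ Commute (a : GL (Fin 2) F) b := by
    intro a b
    simp only [Commute, SemiconjBy, ← Subgroup.coe_mul, Subtype.coe_inj]
  refine ⟨?_, ?_, ?_⟩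
  · intro z hz g
    rw [Subgroup.mem_subgroupOf, Subgroup.mem_center_iff] at hz
    rw [hcoe]
    exact (hz g).symm
  · intro x y w hy h1 h2
    rw [hcoe] at *
    exact commute_of_commute_noncentral hy h1 h2
  · intro x hx g h h1 h2 h3 h4
    rw [hcoe] at *
    push_cast at *
    have hx' : (x : GL (Fin 2) F) ∉ Subgroup.center (GL (Fin 2) F) := hx
    have hd := fun e => hx' (hG x x.2 e)
    have e1 := conj_eq_of_commute hd hx' h1 h3
    have e2 := conj_eq_of_commute hd hx' h2 h4
    have e3 := conj_conj_eq_of_commute e1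
    have e4 := conj_conj_eq_of_commute e2
    have e5 := Units.ext (e1.trans e2.symm)
    clear e1 e2 h1 h2 h3 h4
    generalize (g : GL (Fin 2) F) = g at *
    generalize (h : GL (Fin 2) F) = h at *
    generalize (x : GL (Fin 2) F) = x at *
    rw [e5] at e3
    have e6 : h⁻¹ * x * h = h * x * h⁻¹ := by
      conv_lhs => rw [← e4]
      group
    have e7 : g * h⁻¹ * x * (g * h⁻¹)⁻¹ = x := by
      have : g * h⁻¹ * x * (g * h⁻¹)⁻¹ = g * (h⁻¹ * x * h) * g⁻¹ := by group
      rw [this, e6, e3]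
    exact mul_inv_eq_iff_eq_mul.mp e7

/-- The elements of `G` commuting with `y`. -/
def centralizerIn (G : Subgroup (GL (Fin 2) F)) (y : GL (Fin 2) F) :
    Subgroup (GL (Fin 2) F) := G ⊓ Subgroup.centralizer {y}

lemma mem_centralizerIn {G : Subgroup (GL (Fin 2) F)} {w y : GL (Fin 2) F} :
    w ∈ centralizerIn G y ↔ w ∈ G ∧ Commute w y := by
  simp [centralizerIn, Subgroup.mem_centralizer_singleton_iff, Commute, SemiconjBy]

lemma card_centralizerIn (G : Subgroup (GL (Fin 2) F)) (y : G) :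
    Nat.card (centralizerIn G y) = {w : G | Commute w y}.ncard := by
  rw [← Set.ncard_image_of_injective _ Subtype.val_injective]
  change (centralizerIn G y : Set (GL (Fin 2) F)).ncard = _
  congr 1
  ext w
  simp only [SetLike.mem_coe, mem_centralizerIn, Set.mem_image, Set.mem_ofPred_eq,
    Subtype.exists, exists_and_right, exists_eq_right]
  constructor
  · rintro ⟨hw, hc⟩
    exact ⟨hw, Subtype.ext hc.eq⟩
  · rintro ⟨hw, hc⟩
    exact ⟨hw, congrArg Subtype.val hc.eq⟩

lemma card_center_subgroupOf (G : Subgroup (GL (Fin 2) F)) :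
    Nat.card ((Subgroup.center (GL (Fin 2) F)).subgroupOf G)
      = Nat.card (G ⊓ Subgroup.center (GL (Fin 2) F) : Subgroup (GL (Fin 2) F)) := by
  rw [← Subgroup.inf_subgroupOf_left]
  exact Nat.card_congr (Subgroup.subgroupOfEquivOfLe inf_le_left).toEquiv

/-- The centralizer of a noncentral element is cyclic modulo scalars. -/
lemma exists_generator [Finite F] {G : Subgroup (GL (Fin 2) F)} {x : GL (Fin 2) F}
    (hd : x.val.trace ^ 2 ≠ 4 * x.val.det) (hx : x ∉ Subgroup.center (GL (Fin 2) F)) :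
    ∃ r ∈ centralizerIn G x, ∀ y ∈ centralizerIn G x, ∃ k : ℤ,
      r ^ k * y ∈ Subgroup.center (GL (Fin 2) F) := by
  let K := AlgebraicClosure F
  let φ := algebraMap F K
  obtain ⟨u, hu⟩ : ∃ u : K, u ^ 2 - φ x.val.trace * u + φ x.val.det = 0 := by
    obtain ⟨u, hu⟩ := IsAlgClosed.exists_root
      (Polynomial.X ^ 2 - Polynomial.C (φ x.val.trace) * Polynomial.X
        + Polynomial.C (φ x.val.det)) (by
          have : (Polynomial.X ^ 2 - Polynomial.C (φ x.val.trace) * Polynomial.X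
            + Polynomial.C (φ x.val.det)).degree = 2 := by compute_degree!
          rw [this]; decide)
    exact ⟨u, by simpa using hu⟩
  set v : K := φ x.val.trace - u with hv
  have hsum : φ x.val.trace = u + v := by rw [hv]; ring
  have hprod : φ x.val.det = u * v := by rw [hv]; linear_combination hu
  have huv : u - v ≠ 0 := by
    intro h
    apply hd
    apply (algebraMap F K).injective
    change φ _ = φ _
    rw [map_pow, map_mul, hsum, hprod, map_ofNat]
    linear_combination (u - v) * h
  let e₁ : GL (Fin 2) F → K := fun y => (φ (y.val * x.val).trace - v * φ y.val.trace) / (u - v)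
  let e₂ : GL (Fin 2) F → K := fun y => (φ (y.val * x.val).trace - u * φ y.val.trace) / (v - u)
  have huv' : v - u ≠ 0 := by rwa [← neg_ne_zero, neg_sub]
  have he : ∀ (y : GL (Fin 2) F) (α β : F),
      y.val = α • (1 : Matrix (Fin 2) (Fin 2) F) + β • x.val →
      e₁ y = φ α + φ β * u ∧ e₂ y = φ α + φ β * v := by
    intro y α β h
    have h1 : (y.val * x.val).trace
        = α * x.val.trace + β * (x.val.trace ^ 2 - 2 * x.val.det) := by
      rw [h]
      simp [Matrix.det_fin_two, Matrix.trace_fin_two, Matrix.mul_apply, Fin.sum_univ_two]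
      ring
    have h2 : y.val.trace = 2 * α + β * x.val.trace := by
      rw [h, trace_smul_one_add_smul]
    simp only [e₁, e₂, h1, h2, map_add, map_mul, map_sub, map_pow, map_ofNat, hsum, hprod]
    constructor
    · rw [div_eq_iff huv]
      ring
    · rw [div_eq_iff huv']
      ring
  have hmul : ∀ y w : GL (Fin 2) F, Commute y x → Commute w x →
      e₁ (y * w) = e₁ y * e₁ w ∧ e₂ (y * w) = e₂ y * e₂ w := by
    intro y w hy hw
    obtain ⟨α, β, hy⟩ := val_eq_of_commute hx hy
    obtain ⟨γ, δ, hw⟩ := val_eq_of_commute hx hw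
    have hyw : (y * w).val = (α * γ - β * δ * x.val.det) • (1 : Matrix (Fin 2) (Fin 2) F)
        + (α * δ + β * γ + β * δ * x.val.trace) • x.val := by
      rw [Units.val_mul, hy, hw]
      ext i j
      fin_cases i <;> fin_cases j <;>
        simp [Matrix.mul_apply, Fin.sum_univ_two, Matrix.det_fin_two, Matrix.trace_fin_two] <;>
        ring
    obtain ⟨a1, a2⟩ := he _ _ _ hy
    obtain ⟨b1, b2⟩ := he _ _ _ hw
    obtain ⟨c1, c2⟩ := he _ _ _ hyw
    rw [a1, a2, b1, b2, c1, c2]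
    simp only [map_add, map_mul, map_sub, hsum, hprod]
    constructor <;> ring
  have hone : e₁ 1 = 1 ∧ e₂ 1 = 1 := by
    simpa using he 1 1 0 (by simp)
  let ψ₀ : centralizerIn G x →* K :=
    { toFun := fun y => e₁ y / e₂ y
      map_one' := by simp [hone]
      map_mul' := by
        intro y w
        have := hmul y w (mem_centralizerIn.mp y.2).2 (mem_centralizerIn.mp w.2).2
        rw [Subgroup.coe_mul, this.1, this.2, mul_div_mul_comm] }
  let ψ := ψ₀.toHomUnits
  have hker : ∀ y : centralizerIn G x, ψ y = 1 →
      (y : GL (Fin 2) F) ∈ Subgroup.center (GL (Fin 2) F) := by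
    intro y hy
    have h1 : e₁ y / e₂ y = 1 := congrArg Units.val hy
    have h2 : e₂ y ≠ 0 := by
      intro h0
      simp [h0] at h1
    rw [div_eq_one_iff_eq h2] at h1
    obtain ⟨α, β, e⟩ := val_eq_of_commute hx (mem_centralizerIn.mp y.2).2
    obtain ⟨a1, a2⟩ := he _ _ _ e
    rw [a1, a2] at h1
    have h3 : φ β * (u - v) = 0 := by linear_combination h1
    have h4 : β = 0 := by
      have := (mul_eq_zero.mp h3).resolve_right huv
      exact (map_eq_zero φ).mp this
    rw [mem_center_iff_isScalarMat, e, h4]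
    simp [IsScalarMat]
  have : Finite (GL (Fin 2) F) := inferInstance
  have : Finite ψ.range := Set.finite_range ψ
  have hcyc : IsCyclic ψ.range := inferInstance
  obtain ⟨⟨_, ⟨r, rfl⟩⟩, hr⟩ := hcyc.exists_generator
  refine ⟨r, r.2, fun y hy => ?_⟩
  obtain ⟨k, hk⟩ := Subgroup.mem_zpowers_iff.mp (hr ⟨ψ ⟨y, hy⟩, ⟨⟨y, hy⟩, rfl⟩⟩)
  have hk' : ψ r ^ k = ψ ⟨y, hy⟩ := congrArg Subtype.val hk
  refine ⟨-k, ?_⟩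
  have := hker (r ^ (-k) * ⟨y, hy⟩) (by rw [map_mul, map_zpow, ← hk']; simp)
  simpa using this

end SeparableGroups

section TopElements

variable {F : Type*} [Field F]

/-- The conjugate `cGc⁻¹` of a subgroup. -/
abbrev conjSubgroup {Γ : Type*} [Group Γ] (c : Γ) (G : Subgroup Γ) : Subgroup Γ :=
  Subgroup.map (MulAut.conj c).toMonoidHom G

lemma mem_conjSubgroup {Γ : Type*} [Group Γ] {c x : Γ} {G : Subgroup Γ} :
    x ∈ conjSubgroup c G ↔ ∃ g ∈ G, c * g * c⁻¹ = x := by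
  simp [conjSubgroup, Subgroup.mem_map]

lemma conj_mem_conjSubgroup {Γ : Type*} [Group Γ] {c g : Γ} {G : Subgroup Γ} :
    c * g * c⁻¹ ∈ conjSubgroup c G ↔ g ∈ G := by
  simp

lemma card_conjSubgroup {Γ : Type*} [Group Γ] (c : Γ) (G : Subgroup Γ) :
    Nat.card (conjSubgroup c G) = Nat.card G :=
  (Nat.card_congr (G.equivMapOfInjective _ (MulAut.conj c).injective).toEquiv).symm

lemma conjSubgroup_conjSubgroup {Γ : Type*} [Group Γ] (c d : Γ) (G : Subgroup Γ) :
    conjSubgroup c (conjSubgroup d G) = conjSubgroup (c * d) G := by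
  ext x
  simp [mul_assoc]

lemma conjSubgroup_one {Γ : Type*} [Group Γ] (G : Subgroup Γ) : conjSubgroup 1 G = G := by
  ext x
  simp

/-- The pairs (determinant, trace) of the elements of `G`. -/
def detTraceSet (G : Subgroup (GL (Fin 2) F)) : Set (F × F) :=
  (fun g : GL (Fin 2) F => (g.val.det, g.val.trace)) '' G

lemma exists_mem_of_detTraceSet_eq {G H : Subgroup (GL (Fin 2) F)}
    (h : detTraceSet G = detTraceSet H) {g : GL (Fin 2) F} (hg : g ∈ G) :
    ∃ k ∈ H, k.val.det = g.val.det ∧ k.val.trace = g.val.trace := by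
  have : (g.val.det, g.val.trace) ∈ detTraceSet H := h ▸ ⟨g, hg, rfl⟩
  obtain ⟨k, hk, e⟩ := this
  exact ⟨k, hk, congrArg Prod.fst e, congrArg Prod.snd e⟩

lemma detTraceSet_conjSubgroup (c : GL (Fin 2) F) (G : Subgroup (GL (Fin 2) F)) :
    detTraceSet (conjSubgroup c G) = detTraceSet G := by
  ext p
  constructor
  · rintro ⟨x, hx, rfl⟩
    obtain ⟨g, hg, rfl⟩ := mem_conjSubgroup.mp hx
    exact ⟨g, hg, by simp only [det_conj_val, trace_conj_val]⟩
  · rintro ⟨g, hg, rfl⟩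
    exact ⟨c * g * c⁻¹, conj_mem_conjSubgroup.mpr hg, by simp only [det_conj_val, trace_conj_val]⟩

lemma conj_mem_center_iff {Γ : Type*} [Group Γ] {c g : Γ} :
    c * g * c⁻¹ ∈ Subgroup.center Γ ↔ g ∈ Subgroup.center Γ := by
  constructor
  · intro h
    have := (inferInstance : (Subgroup.center Γ).Normal).conj_mem _ h c⁻¹
    simpa [mul_assoc] using this
  · intro h
    exact (inferInstance : (Subgroup.center Γ).Normal).conj_mem _ h c

lemma IsSeparableGroup.conj {G : Subgroup (GL (Fin 2) F)} (hG : IsSeparableGroup G)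
    (c : GL (Fin 2) F) : IsSeparableGroup (conjSubgroup c G) := by
  intro x hx h
  obtain ⟨g, hg, rfl⟩ := mem_conjSubgroup.mp hx
  rw [trace_conj_val, det_conj_val] at h
  exact conj_mem_center_iff.mpr (hG g hg h)

lemma IsSeparableGroup.mono {G K : Subgroup (GL (Fin 2) F)} (hG : IsSeparableGroup G)
    (h : K ≤ G) : IsSeparableGroup K := fun g hg => hG g (h hg)

lemma trace_sq_eq_of_mem_center {g : GL (Fin 2) F} (h : g ∈ Subgroup.center (GL (Fin 2) F)) :
    g.val.trace ^ 2 = 4 * g.val.det := by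
  obtain ⟨h1, h2, h3⟩ := (mem_center_iff_isScalarMat g).mp h
  rw [Matrix.trace_fin_two, Matrix.det_fin_two, h1, h2, h3]
  ring

lemma eq_of_mem_center {g k : GL (Fin 2) F} (hg : g ∈ Subgroup.center (GL (Fin 2) F))
    (hk : k ∈ Subgroup.center (GL (Fin 2) F)) (hd : k.val.det = g.val.det)
    (ht : k.val.trace = g.val.trace) : k = g := by
  obtain ⟨h1, h2, h3⟩ := (mem_center_iff_isScalarMat g).mp hg
  obtain ⟨k1, k2, k3⟩ := (mem_center_iff_isScalarMat k).mp hk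
  rw [Matrix.trace_fin_two, Matrix.trace_fin_two, h3, k3] at ht
  rw [Matrix.det_fin_two, Matrix.det_fin_two, h1, k1, h3, k3] at hd
  have h : k.val 1 1 = g.val 1 1 := by
    have : (k.val 1 1 - g.val 1 1) ^ 2 = 0 := by linear_combination hd - g.val 1 1 * ht
    exact sub_eq_zero.mp (pow_eq_zero_iff (two_ne_zero) |>.mp this)
  apply Units.ext
  ext i j
  fin_cases i <;> fin_cases j <;> simp [h1, h2, h3, k1, k2, k3, h]

lemma inf_center_le_of_detTraceSet_eq {G H : Subgroup (GL (Fin 2) F)} (hH : IsSeparableGroup H)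
    (h : detTraceSet G = detTraceSet H) : G ⊓ Subgroup.center (GL (Fin 2) F) ≤ H := by
  rintro g ⟨hg, hgc⟩
  obtain ⟨k, hk, hd, ht⟩ := exists_mem_of_detTraceSet_eq h hg
  have hkc := hH k hk (by rw [hd, ht]; exact trace_sq_eq_of_mem_center hgc)
  rwa [← eq_of_mem_center hgc hkc hd ht]

lemma inf_center_eq_of_detTraceSet_eq {G H : Subgroup (GL (Fin 2) F)} (hG : IsSeparableGroup G)
    (hH : IsSeparableGroup H) (h : detTraceSet G = detTraceSet H) :
    G ⊓ Subgroup.center (GL (Fin 2) F) = H ⊓ Subgroup.center (GL (Fin 2) F) :=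
  le_antisymm (le_inf (inf_center_le_of_detTraceSet_eq hH h) inf_le_right)
    (le_inf (inf_center_le_of_detTraceSet_eq hG h.symm) inf_le_right)

/-- `r` is a noncentral element of `G` with centralizer as large as possible, generating
this centralizer modulo scalars. -/
structure IsTopElement (G : Subgroup (GL (Fin 2) F)) (r : GL (Fin 2) F) : Prop where
  mem : r ∈ G
  notMem_center : r ∉ Subgroup.center (GL (Fin 2) F)
  card_le : ∀ y ∈ G, y ∉ Subgroup.center (GL (Fin 2) F) →
    Nat.card (centralizerIn G y) ≤ Nat.card (centralizerIn G r)
  exists_zpow : ∀ y ∈ centralizerIn G r, ∃ k : ℤ, r ^ k * y ∈ Subgroup.center (GL (Fin 2) F)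

lemma exists_isTopElement [Finite F] {G : Subgroup (GL (Fin 2) F)} (hG : IsSeparableGroup G)
    (hc : ¬ G ≤ Subgroup.center (GL (Fin 2) F)) : ∃ r, IsTopElement G r := by
  obtain ⟨x₀, hx₀, hx₀c⟩ := SetLike.not_le_iff_exists.mp hc
  let S : Set (GL (Fin 2) F) := {y | y ∈ G ∧ y ∉ Subgroup.center (GL (Fin 2) F)}
  obtain ⟨x, ⟨hx, hxc⟩, hmax⟩ := Set.exists_max_image S (fun y => Nat.card (centralizerIn G y))
    (Set.toFinite _) ⟨x₀, hx₀, hx₀c⟩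
  obtain ⟨r, hr, hgen⟩ := exists_generator (G := G) (fun e => hxc (hG x hx e)) hxc
  have hrc : r ∉ Subgroup.center (GL (Fin 2) F) := by
    intro hrc
    obtain ⟨k, hk⟩ := hgen x (mem_centralizerIn.mpr ⟨hx, Commute.refl x⟩)
    exact hxc ((Subgroup.mul_mem_cancel_left _ (Subgroup.zpow_mem _ hrc k)).mp hk)
  have hrx := (mem_centralizerIn.mp hr).2
  have heq : centralizerIn G r = centralizerIn G x := by
    ext w
    simp only [mem_centralizerIn]
    exact and_congr_right fun _ => ⟨fun h => commute_of_commute_noncentral hrc h hrx,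
      fun h => commute_of_commute_noncentral hxc h hrx.symm⟩
  refine ⟨r, (mem_centralizerIn.mp hr).1, hrc, fun y hy hyc => ?_, fun y hy => ?_⟩
  · rw [heq]
    exact hmax y ⟨hy, hyc⟩
  · exact hgen y (heq ▸ hy)

lemma IsTopElement.centralizerIn_le {G H : Subgroup (GL (Fin 2) F)} {r : GL (Fin 2) F}
    (h : IsTopElement G r) (hr : r ∈ H) (hZ : G ⊓ Subgroup.center (GL (Fin 2) F) ≤ H) :
    centralizerIn G r ≤ centralizerIn H r := by
  intro y hy
  obtain ⟨k, hk⟩ := h.exists_zpow y hy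
  obtain ⟨hyG, hyr⟩ := mem_centralizerIn.mp hy
  refine mem_centralizerIn.mpr ⟨?_, hyr⟩
  have : r ^ k * y ∈ H := hZ ⟨G.mul_mem (G.zpow_mem h.mem k) hyG, hk⟩
  exact (Subgroup.mul_mem_cancel_left _ (H.zpow_mem hr k)).mp this

lemma card_centralizerIn_conjSubgroup (G : Subgroup (GL (Fin 2) F)) (c g : GL (Fin 2) F) :
    Nat.card (centralizerIn (conjSubgroup c G) (c * g * c⁻¹)) = Nat.card (centralizerIn G g) := by
  rw [← card_conjSubgroup c (centralizerIn G g)]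
  have : centralizerIn (conjSubgroup c G) (c * g * c⁻¹) = conjSubgroup c (centralizerIn G g) := by
    ext x
    simp only [mem_centralizerIn, mem_conjSubgroup]
    constructor
    · rintro ⟨⟨y, hy, rfl⟩, h⟩
      exact ⟨y, ⟨hy, (commute_conj_iff _ _ _).mp h⟩, rfl⟩
    · rintro ⟨y, ⟨hy, h⟩, rfl⟩
      exact ⟨⟨y, hy, rfl⟩, (commute_conj_iff _ _ _).mpr h⟩
  rw [this]

lemma exists_conj_of_notMem_center {a b : GL (Fin 2) F}
    (ha : a ∉ Subgroup.center (GL (Fin 2) F)) (hb : b ∉ Subgroup.center (GL (Fin 2) F))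
    (hd : a.val.det = b.val.det) (ht : a.val.trace = b.val.trace) : ∃ c, c * a * c⁻¹ = b := by
  rw [mem_center_iff_isScalarMat] at ha hb
  exact exists_conj_of_nonscalar a b ha hb hd ht

/-- A noncentral element of `G` is conjugate to an element of any separable group with the same
determinants and traces. -/
lemma exists_conj_mem {G H : Subgroup (GL (Fin 2) F)} (hG : IsSeparableGroup G)
    (h : detTraceSet G = detTraceSet H) {g : GL (Fin 2) F} (hg : g ∈ G)
    (hgc : g ∉ Subgroup.center (GL (Fin 2) F)) : ∃ k ∈ H, ∃ c, c * k * c⁻¹ = g := by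
  obtain ⟨k, hk, hd, ht⟩ := exists_mem_of_detTraceSet_eq h hg
  refine ⟨k, hk, exists_conj_of_notMem_center (fun hkc => hgc (hG g hg ?_)) hgc hd ht⟩
  rw [← hd, ← ht]
  exact trace_sq_eq_of_mem_center hkc

lemma IsTopElement.card_le_of_detTraceSet_eq [Finite F] {G H : Subgroup (GL (Fin 2) F)}
    {r : GL (Fin 2) F} (hr : IsTopElement G r) (hG : IsSeparableGroup G) (hH : IsSeparableGroup H)
    (h : detTraceSet G = detTraceSet H) {y : GL (Fin 2) F} (hy : y ∈ H)
    (hyc : y ∉ Subgroup.center (GL (Fin 2) F)) :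
    Nat.card (centralizerIn H y) ≤ Nat.card (centralizerIn G r) := by
  obtain ⟨s, hs⟩ := exists_isTopElement hH (fun hle => hyc (hle hy))
  obtain ⟨g, hg, c, rfl⟩ := exists_conj_mem hH h.symm hs.mem hs.notMem_center
  have hle := hs.centralizerIn_le (H := conjSubgroup c G)
    (conj_mem_conjSubgroup.mpr hg)
    (inf_center_le_of_detTraceSet_eq (hG.conj c)
      (h.symm.trans (detTraceSet_conjSubgroup c G).symm))
  calc Nat.card (centralizerIn H y) ≤ Nat.card (centralizerIn H (c * g * c⁻¹)) :=
        hs.card_le y hy hyc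
    _ ≤ Nat.card (centralizerIn (conjSubgroup c G) (c * g * c⁻¹)) :=
        Nat.card_le_card_of_injective _ (Subgroup.inclusion_injective hle)
    _ = Nat.card (centralizerIn G g) := card_centralizerIn_conjSubgroup _ _ _
    _ ≤ Nat.card (centralizerIn G r) :=
        hr.card_le g hg (fun hgc => hs.notMem_center (conj_mem_center_iff.mpr hgc))

lemma IsTopElement.centralizerIn_eq [Finite F] {G H : Subgroup (GL (Fin 2) F)}
    {r : GL (Fin 2) F} (hr : IsTopElement G r) (hG : IsSeparableGroup G) (hH : IsSeparableGroup H)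
    (h : detTraceSet G = detTraceSet H) (hrH : r ∈ H) :
    centralizerIn H r = centralizerIn G r := by
  refine (Subgroup.eq_of_le_of_card_ge
    (hr.centralizerIn_le hrH (inf_center_le_of_detTraceSet_eq hH h)) ?_).symm
  exact hr.card_le_of_detTraceSet_eq hG hH h hrH hr.notMem_center

lemma IsTopElement.of_detTraceSet_eq [Finite F] {G H : Subgroup (GL (Fin 2) F)}
    {r : GL (Fin 2) F} (hr : IsTopElement G r) (hG : IsSeparableGroup G) (hH : IsSeparableGroup H)
    (h : detTraceSet G = detTraceSet H) (hrH : r ∈ H) : IsTopElement H r := by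
  have heq := hr.centralizerIn_eq hG hH h hrH
  refine ⟨hrH, hr.notMem_center, fun y hy hyc => ?_, fun y hy => ?_⟩
  · rw [heq]
    exact hr.card_le_of_detTraceSet_eq hG hH h hy hyc
  · exact hr.exists_zpow y (heq ▸ hy)

lemma IsTopElement.exists_conjSubgroup [Finite F] {G H : Subgroup (GL (Fin 2) F)}
    {r : GL (Fin 2) F} (hr : IsTopElement G r) (hG : IsSeparableGroup G) (hH : IsSeparableGroup H)
    (h : detTraceSet G = detTraceSet H) : ∃ c, IsTopElement (conjSubgroup c H) r := by
  obtain ⟨k, hk, c, rfl⟩ := exists_conj_mem hG h hr.mem hr.notMem_center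
  exact ⟨c, hr.of_detTraceSet_eq hG (hH.conj c)
    (h.trans (detTraceSet_conjSubgroup c H).symm) (conj_mem_conjSubgroup.mpr hk)⟩

/-- The possible orders of a separable group, relative to the order `z` of its subgroup of scalars
and the order `z * n` of a largest centralizer. -/
lemma IsTopElement.card_cases [Finite F] {G : Subgroup (GL (Fin 2) F)} {r : GL (Fin 2) F}
    (hr : IsTopElement G r) (hG : IsSeparableGroup G) {z : ℕ}
    (hz : Nat.card (G ⊓ Subgroup.center (GL (Fin 2) F) : Subgroup (GL (Fin 2) F)) = z) :
    ∃ n, 2 ≤ n ∧ Nat.card (centralizerIn G r) = z * n ∧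
      (Nat.card G = z * n ∨ Nat.card G = z * (2 * n) ∨
        (n = 3 ∧ Nat.card G = z * 12) ∨ (n = 4 ∧ Nat.card G = z * 24) ∨
        (n = 5 ∧ Nat.card G = z * 60 ∧ ∀ y ∈ G, y ∉ Subgroup.center (GL (Fin 2) F) →
          Nat.card (centralizerIn G y) = z * 5 ∨ Nat.card (centralizerIn G y) = z * 3 ∨
          Nat.card (centralizerIn G y) = z * 2)) := by
  have h := hG.isTwistedCA.card_cases (x := ⟨r, hr.mem⟩) hr.notMem_center (fun y hy => by
    have := hr.card_le y y.2 hy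
    rwa [card_centralizerIn, show r = ((⟨r, hr.mem⟩ : G) : GL (Fin 2) F) from rfl,
      card_centralizerIn] at this)
  rw [card_center_subgroupOf, hz, ← card_centralizerIn] at h
  obtain ⟨n, h1, h2, h3⟩ := h
  refine ⟨n, h1, h2, ?_⟩
  rcases h3 with h3 | h3 | h3 | h3 | ⟨h3, h4, h5⟩
  · exact Or.inl h3
  · exact Or.inr (Or.inl h3)
  · exact Or.inr (Or.inr (Or.inl h3))
  · exact Or.inr (Or.inr (Or.inr (Or.inl h3)))
  · refine Or.inr (Or.inr (Or.inr (Or.inr ⟨h3, h4, fun y hy hyc => ?_⟩)))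
    have := h5 ⟨y, hy⟩ hyc
    rwa [← card_centralizerIn] at this

end TopElements

section AllowedRatios

variable {F : Type*} [Field F]

/-- The possible values of `(tr y)² / det y` for the noncentral elements `y` of a group whose image
modulo scalars is tetrahedral (`n = 3`), octahedral (`n = 4`) or icosahedral (`n = 5`). -/
def AllowedRatio (n : ℕ) (x : F) : Prop :=
  x = 0 ∨ x = 1 ∨ (n = 4 ∧ x = 2) ∨ (n = 5 ∧ x ^ 2 - 3 * x + 1 = 0)

lemma tetrahedral_ratio (h2 : (2 : F) ≠ 0) (h3 : (3 : F) ≠ 0) {p : F}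
    (e1 : AllowedRatio 3 (p ^ 2)) (e2 : AllowedRatio 3 ((1 - p) ^ 2)) : p = 1 ∨ p = 0 := by
  simp only [AllowedRatio] at e1 e2
  norm_num at e1 e2
  grind

lemma octahedral_ratio (h2 : (2 : F) ≠ 0) (h3 : (3 : F) ≠ 0) {p : F}
    (e1 : AllowedRatio 4 (p ^ 2)) (e2 : AllowedRatio 4 ((2 - p) ^ 2))
    (e3 : AllowedRatio 4 ((2 * 2 + p ^ 2 - 2 * p - 2) ^ 2)) : p = 1 := by
  have h : ∀ x : F, AllowedRatio 4 x → x = 0 ∨ x = 1 ∨ x = 2 := by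
    rintro x (h | h | ⟨-, h⟩ | ⟨h, -⟩)
    · exact Or.inl h
    · exact Or.inr (Or.inl h)
    · exact Or.inr (Or.inr h)
    · omega
  have unit : ∀ i j : ℕ, (2 : F) ^ i * 3 ^ j ≠ 0 := fun i j =>
    mul_ne_zero (pow_ne_zero _ h2) (pow_ne_zero _ h3)
  rcases h _ e1 with e1 | e1 | e1
  · have hp : p = 0 := pow_eq_zero_iff two_ne_zero |>.mp e1
    subst hp
    exfalso
    rcases h _ e2 with e2 | e2 | e2
    · exact unit 2 0 (by linear_combination e2)
    · exact unit 0 1 (by linear_combination e2)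
    · exact unit 1 0 (by linear_combination e2)
  · rcases sq_eq_one_iff.mp e1 with hp | hp
    · exact hp
    · subst hp
      exfalso
      rcases h _ e2 with e2 | e2 | e2
      · exact unit 0 2 (by linear_combination e2)
      · exact unit 3 0 (by linear_combination e2)
      · rcases h _ e3 with e3 | e3 | e3
        · exact unit 2 0 (by linear_combination e3 - 3 * e2)
        · exact unit 0 1 (by linear_combination e3 - 3 * e2)
        · exact unit 1 0 (by linear_combination e3 - 3 * e2)
  · exfalso
    rcases h _ e2 with e2 | e2 | e2
    · exact unit 2 0 (by linear_combination (6 + 4 * p) * e2 - (4 * p - 10) * e1)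
    · have h7 : (7 : F) = 0 := by linear_combination (4 * p + 5) * (e1 - e2) - 16 * e1
      have hp : p = 3 := by linear_combination 2 * (e1 - e2) + (1 - p) * h7
      rcases h _ e3 with e3 | e3 | e3
      · subst hp; exact unit 2 0 (by linear_combination e3 - 3 * h7)
      · subst hp; exact unit 0 1 (by linear_combination e3 - 3 * h7)
      · subst hp; exact unit 1 0 (by linear_combination e3 - 3 * h7)
    · exact unit 4 0 (by linear_combination (4 * p + 4) * (e1 - e2) - 16 * e1)

lemma icosahedral_ratio (h2 : (2 : F) ≠ 0) (h3 : (3 : F) ≠ 0) (h5 : (5 : F) ≠ 0) {τ p : F}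
    (hτ : τ ^ 2 - 3 * τ + 1 = 0)
    (e1 : AllowedRatio 5 (p ^ 2)) (e2 : AllowedRatio 5 ((τ - p) ^ 2))
    (e4 : AllowedRatio 5 (τ * (p - 1) ^ 2)) : p = 1 ∨ p = τ - 1 := by
  have h : ∀ x : F, AllowedRatio 5 x → x = 0 ∨ x = 1 ∨ x = τ ∨ x = 3 - τ := by
    rintro x (h | h | ⟨h, -⟩ | ⟨-, h⟩)
    · exact Or.inl h
    · exact Or.inr (Or.inl h)
    · omega
    · have : (x - τ) * (x - (3 - τ)) = 0 := by linear_combination h - hτ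
      rcases mul_eq_zero.mp this with h | h
      · exact Or.inr (Or.inr (Or.inl (sub_eq_zero.mp h)))
      · exact Or.inr (Or.inr (Or.inr (sub_eq_zero.mp h)))
  have nz : ∀ (a b : ℤ) (i j k : ℕ), (a ^ 2 + 3 * a * b + b ^ 2) ^ 2 = 2 ^ i * 3 ^ j * 5 ^ k →
      (a : F) + b * τ ≠ 0 := by
    intro a b i j k hN h0
    have e : ((a : F) ^ 2 + 3 * a * b + b ^ 2) ^ 2 = 2 ^ i * 3 ^ j * 5 ^ k := by
      exact_mod_cast congrArg (Int.cast : ℤ → F) hN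
    have e' : (a : F) ^ 2 + 3 * a * b + b ^ 2 = 0 := by
      linear_combination (a + b * (3 - τ)) * h0 + (b : F) ^ 2 * hτ
    rw [e', zero_pow two_ne_zero] at e
    exact mul_ne_zero (mul_ne_zero (pow_ne_zero _ h2) (pow_ne_zero _ h3)) (pow_ne_zero _ h5) e.symm
  have sq : ∀ a : F, p ^ 2 = a ^ 2 → p = a ∨ p = -a := fun a h => sq_eq_sq_iff_eq_or_eq_neg.mp h
  have hp : p = 0 ∨ p = 1 ∨ p = -1 ∨ p = τ - 1 ∨ p = -(τ - 1) ∨ p = 2 - τ ∨ p = -(2 - τ) := by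
    rcases h _ e1 with h | h | h | h
    · exact Or.inl (pow_eq_zero_iff two_ne_zero |>.mp h)
    · have := sq 1 (by linear_combination h)
      tauto
    · have := sq (τ - 1) (by linear_combination h - hτ)
      tauto
    · have := sq (2 - τ) (by linear_combination h - hτ)
      tauto
  rcases hp with rfl | rfl | rfl | rfl | rfl | rfl | rfl
  · exfalso
    rcases h _ e2 with e2 | e2 | e2 | e2
    · exact nz (-1) 3 0 0 0 (by norm_num) (by push_cast; linear_combination e2 - hτ)
    · exact nz (-2) 3 0 0 2 (by norm_num) (by push_cast; linear_combination e2 - hτ)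
    · exact nz (-1) 2 0 0 0 (by norm_num) (by push_cast; linear_combination e2 - hτ)
    · exact nz (-4) 4 8 0 0 (by norm_num) (by push_cast; linear_combination e2 - hτ)
  · exact Or.inl rfl
  · exfalso
    rcases h _ e2 with e2 | e2 | e2 | e2
    · exact nz 0 5 0 0 4 (by norm_num) (by push_cast; linear_combination e2 - hτ)
    · rcases h _ e4 with e4 | e4 | e4 | e4
      · exact nz 0 4 8 0 0 (by norm_num) (by push_cast; linear_combination e4)
      · exact nz (-1) 4 0 0 2 (by norm_num) (by push_cast; linear_combination e4)
      · exact nz 0 3 0 4 0 (by norm_num) (by push_cast; linear_combination e4)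
      · exact nz 2 0 4 0 0 (by norm_num) (by push_cast; linear_combination e2 - hτ - e4)
    · exact nz 0 4 8 0 0 (by norm_num) (by push_cast; linear_combination e2 - hτ)
    · exact nz (-3) 6 0 4 0 (by norm_num) (by push_cast; linear_combination e2 - hτ)
  · exact Or.inr rfl
  · exfalso
    rcases h _ e2 with e2 | e2 | e2 | e2
    · exact nz (-3) 8 0 0 0 (by norm_num) (by push_cast; linear_combination e2 - 4 * hτ)
    · exact nz (-4) 8 8 0 0 (by norm_num) (by push_cast; linear_combination e2 - 4 * hτ)
    · exact nz (-3) 7 0 0 2 (by norm_num) (by push_cast; linear_combination e2 - 4 * hτ)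
    · exact nz (-6) 9 0 4 2 (by norm_num) (by push_cast; linear_combination e2 - 4 * hτ)
  · exfalso
    rcases h _ e4 with e4 | e4 | e4 | e4
    · exact nz (-1) 3 0 0 0 (by norm_num) (by push_cast; linear_combination e4 - (τ + 1) * hτ)
    · exact nz (-2) 3 0 0 2 (by norm_num) (by push_cast; linear_combination e4 - (τ + 1) * hτ)
    · exact nz (-1) 2 0 0 0 (by norm_num) (by push_cast; linear_combination e4 - (τ + 1) * hτ)
    · exact nz (-4) 4 8 0 0 (by norm_num) (by push_cast; linear_combination e4 - (τ + 1) * hτ)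
  · exfalso
    rcases h _ e2 with e2 | e2 | e2 | e2
    · exact nz 4 0 8 0 0 (by norm_num) (by push_cast; linear_combination e2)
    · exact nz 3 0 0 4 0 (by norm_num) (by push_cast; linear_combination e2)
    · exact nz 4 (-1) 0 0 2 (by norm_num) (by push_cast; linear_combination e2)
    · exact nz 1 1 0 0 2 (by norm_num) (by push_cast; linear_combination e2)

end AllowedRatios

section GroupElements

variable {F : Type*} [Field F]

lemma mul_self_eq (A : Matrix (Fin 2) (Fin 2) F) :
    A * A = A.trace • A - A.det • (1 : Matrix (Fin 2) (Fin 2) F) := by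
  ext i j
  fin_cases i <;> fin_cases j <;>
    simp [Matrix.mul_apply, Fin.sum_univ_two, Matrix.det_fin_two, Matrix.trace_fin_two] <;> ring

lemma eq_zero_of_smul_add_smul_mem_center {x y : GL (Fin 2) F} {α β : F}
    (hy : y ∉ Subgroup.center (GL (Fin 2) F)) (hx : x ∈ Subgroup.center (GL (Fin 2) F))
    (h : x.val = α • (1 : Matrix (Fin 2) (Fin 2) F) + β • y.val) : β = 0 := by
  rw [mem_center_iff_isScalarMat] at hx hy
  by_contra hβ
  apply hy
  obtain ⟨h1, h2, h3⟩ := hx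
  rw [h] at h1 h2 h3
  simp [hβ] at h1 h2 h3
  exact ⟨h1, h2, h3⟩

lemma val_pow_succ {y : GL (Fin 2) F} {k : ℕ} {α β : F}
    (h : (y ^ k).val = α • (1 : Matrix (Fin 2) (Fin 2) F) + β • y.val) :
    (y ^ (k + 1)).val = (-(β * y.val.det)) • (1 : Matrix (Fin 2) (Fin 2) F)
      + (α + β * y.val.trace) • y.val := by
  rw [pow_succ, Units.val_mul, h, add_mul, smul_mul_assoc, smul_mul_assoc, one_mul, mul_self_eq]
  module

lemma allowedRatio_of_pow_mem_center {y : GL (Fin 2) F} {m n : ℕ}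
    (hy : y ∉ Subgroup.center (GL (Fin 2) F)) (h : y ^ m ∈ Subgroup.center (GL (Fin 2) F))
    (hm : m = 2 ∨ m = 3 ∨ (m = 4 ∧ n = 4) ∨ (m = 5 ∧ n = 5)) :
    AllowedRatio n (y.val.trace ^ 2 / y.val.det) := by
  have hd : y.val.det ≠ 0 := ((Matrix.isUnit_iff_isUnit_det _).mp y.isUnit).ne_zero
  have e1 : (y ^ 1).val = (0 : F) • (1 : Matrix (Fin 2) (Fin 2) F) + (1 : F) • y.val := by simp
  have e2 := val_pow_succ e1
  have e3 := val_pow_succ e2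
  have e4 := val_pow_succ e3
  have e5 := val_pow_succ e4
  set t := y.val.trace
  set d := y.val.det
  rcases hm with rfl | rfl | ⟨rfl, rfl⟩ | ⟨rfl, rfl⟩
  · have h0 := eq_zero_of_smul_add_smul_mem_center hy h e2
    left
    rw [show t = 0 by linear_combination h0]
    simp
  · have h0 := eq_zero_of_smul_add_smul_mem_center hy h e3
    right; left
    rw [div_eq_one_iff_eq hd]
    linear_combination h0
  · have h0 := eq_zero_of_smul_add_smul_mem_center hy h e4
    have : t * (t ^ 2 - 2 * d) = 0 := by linear_combination h0
    rcases mul_eq_zero.mp this with h0 | h0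
    · left
      rw [h0]
      simp
    · right; right; left
      refine ⟨rfl, ?_⟩
      rw [div_eq_iff hd]
      linear_combination h0
  · have h0 := eq_zero_of_smul_add_smul_mem_center hy h e5
    right; right; right
    refine ⟨rfl, ?_⟩
    field_simp
    linear_combination h0

lemma sq_mem_center_of_trace_eq_zero {y : GL (Fin 2) F} (h : y.val.trace = 0) :
    y ^ 2 ∈ Subgroup.center (GL (Fin 2) F) := by
  rw [mem_center_iff_isScalarMat, pow_two, Units.val_mul, mul_self_eq, h]
  simp [IsScalarMat]

lemma pow_three_mem_center_of_trace_sq_eq {y : GL (Fin 2) F} (h : y.val.trace ^ 2 = y.val.det) :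
    y ^ 3 ∈ Subgroup.center (GL (Fin 2) F) := by
  have e1 : (y ^ 1).val = (0 : F) • (1 : Matrix (Fin 2) (Fin 2) F) + (1 : F) • y.val := by simp
  have e3 := val_pow_succ (val_pow_succ e1)
  have h0 : -(1 * y.val.det) + (0 + 1 * y.val.trace) * y.val.trace = 0 := by
    linear_combination h
  rw [h0, zero_smul, add_zero] at e3
  rw [mem_center_iff_isScalarMat]
  change IsScalarMat ((y ^ (1 + 1 + 1)).val)
  rw [e3]
  simp [IsScalarMat]

lemma exists_card_centralizerIn_eq [Finite F] {G : Subgroup (GL (Fin 2) F)} {z : ℕ}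
    (hz : Nat.card (G ⊓ Subgroup.center (GL (Fin 2) F) : Subgroup (GL (Fin 2) F)) = z)
    {y : GL (Fin 2) F} (hy : y ∈ G) :
    ∃ m, Nat.card (centralizerIn G y) = z * m ∧ y ^ m ∈ Subgroup.center (GL (Fin 2) F) ∧
      (IsTopElement G y → ∀ j : ℕ, y ^ j ∈ Subgroup.center (GL (Fin 2) F) → m ∣ j) := by
  let C := centralizerIn G y
  let Z := (Subgroup.center (GL (Fin 2) F)).subgroupOf C
  have hyC : y ∈ C := mem_centralizerIn.mpr ⟨hy, Commute.refl y⟩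
  have hZ : Nat.card Z = z := by
    rw [card_center_subgroupOf, ← hz]
    congr 2
    ext x
    simp only [C, Subgroup.mem_inf, mem_centralizerIn]
    constructor
    · rintro ⟨⟨h1, -⟩, h2⟩
      exact ⟨h1, h2⟩
    · rintro ⟨h1, h2⟩
      exact ⟨⟨h1, ((Subgroup.mem_center_iff.mp h2) y).symm⟩, h2⟩
  refine ⟨Z.index, ?_, ?_, fun hr j hj => ?_⟩
  · rw [← hZ, Subgroup.card_mul_index]
  · have := Z.pow_index_mem (⟨y, hyC⟩ : C)
    exact this
  · have hgen : ∀ q : C ⧸ Z, q ∈ Subgroup.zpowers (QuotientGroup.mk (⟨y, hyC⟩ : C) : C ⧸ Z) := by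
      intro q
      induction q using QuotientGroup.induction_on with
      | H w =>
        obtain ⟨k, hk⟩ := hr.exists_zpow w w.2
        refine Subgroup.mem_zpowers_iff.mpr ⟨-k, ?_⟩
        rw [← QuotientGroup.mk_zpow, QuotientGroup.eq]
        change (((⟨y, hyC⟩ : C) ^ (-k))⁻¹ * w : C).val ∈ Subgroup.center (GL (Fin 2) F)
        simpa using hk
    rw [Subgroup.index, ← orderOf_eq_card_of_forall_mem_zpowers hgen, orderOf_dvd_iff_pow_eq_one,
      ← QuotientGroup.mk_pow, QuotientGroup.eq_one_iff]
    exact hj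

lemma two_le_of_card_centralizerIn_eq [Finite F] {G : Subgroup (GL (Fin 2) F)} {z m : ℕ}
    (hz : Nat.card (G ⊓ Subgroup.center (GL (Fin 2) F) : Subgroup (GL (Fin 2) F)) = z)
    {y : GL (Fin 2) F} (hy : y ∈ G) (hyc : y ∉ Subgroup.center (GL (Fin 2) F))
    (hm : Nat.card (centralizerIn G y) = z * m) : 2 ≤ m := by
  obtain ⟨m', h1, h2, -⟩ := exists_card_centralizerIn_eq hz hy
  have hz0 : 0 < z := hz ▸ Nat.card_pos
  have : m = m' := Nat.eq_of_mul_eq_mul_left hz0 (hm.symm.trans h1)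
  subst this
  by_contra! hlt
  interval_cases m
  · have : 0 < Nat.card (centralizerIn G y) := Nat.card_pos
    omega
  · exact hyc (by simpa using h2)

lemma trace_eq_zero_of_commute_conj {r s : GL (Fin 2) F}
    (hr : r.val.trace ^ 2 ≠ 4 * r.val.det) (hrc : r ∉ Subgroup.center (GL (Fin 2) F))
    (h : Commute (s * r * s⁻¹) r) (hs : ¬ Commute s r) :
    s.val.trace = 0 ∧ (r.val * s.val).trace = 0 := by
  have e := conj_eq_of_commute hr hrc h hs
  have e1 : s.val * r.val = (r.val.trace • (1 : Matrix (Fin 2) (Fin 2) F) - r.val) * s.val := by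
    rw [← e, ← Units.val_mul, ← Units.val_mul]
    simp
  rw [Matrix.trace_fin_two, Matrix.det_fin_two] at hr
  have a := congrFun (congrFun e1 0) 0
  have b := congrFun (congrFun e1 0) 1
  have c := congrFun (congrFun e1 1) 0
  have d := congrFun (congrFun e1 1) 1
  simp [Matrix.mul_apply, Fin.sum_univ_two, Matrix.trace_fin_two] at a b c d
  simp only [Matrix.trace_fin_two, Matrix.mul_apply, Fin.sum_univ_two]
  have hne := sub_ne_zero.mpr hr
  generalize r.val 0 0 = r1 at *
  generalize r.val 0 1 = r2 at *
  generalize r.val 1 0 = r3 at *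
  generalize r.val 1 1 = r4 at *
  generalize s.val 0 0 = s1 at *
  generalize s.val 0 1 = s2 at *
  generalize s.val 1 0 = s3 at *
  generalize s.val 1 1 = s4 at *
  constructor
  · apply (mul_eq_zero.mp _).resolve_left hne
    linear_combination (r1 - r4) * a + 2 * r3 * b + 2 * r2 * c - (r1 - r4) * d
  · apply (mul_eq_zero.mp _).resolve_left hne
    linear_combination (r1 + r4) * (r1 * a + r3 * b + r2 * c + r4 * d)
      - 2 * (r1 * r4 - r2 * r3) * (a + d)

lemma mul_mem_iff_of_card_eq_two_mul {Γ : Type*} [Group Γ] [Finite Γ] {G R : Subgroup Γ}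
    (hR : R ≤ G) (h : Nat.card G = 2 * Nat.card R) {a b : Γ} (ha : a ∈ G) (hb : b ∈ G) :
    a * b ∈ R ↔ (a ∈ R ↔ b ∈ R) := by
  have hidx : (R.subgroupOf G).index = 2 := by
    have h1 := (R.subgroupOf G).card_mul_index
    rw [Nat.card_congr (Subgroup.subgroupOfEquivOfLe hR).toEquiv, h, mul_comm] at h1
    exact Nat.eq_of_mul_eq_mul_right Nat.card_pos h1
  exact Subgroup.mul_mem_iff_of_index_two hidx (a := ⟨a, ha⟩) (b := ⟨b, hb⟩)

end GroupElements

section Dihedral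

variable {F : Type*} [Field F]

lemma conjSubgroup_eq_of_generated {Γ : Type*} [Group Γ] [Finite Γ] {G H Z : Subgroup Γ}
    {c r b : Γ} (hcard : Nat.card G = Nat.card H)
    (hgen : ∀ K ≤ G, r ∈ K → b ∈ K → G ⊓ Z ≤ K → G ≤ K) (hr : r ∈ G) (hb : b ∈ G)
    (hZ : ∀ g ∈ G ⊓ Z, c * g * c⁻¹ ∈ H) (hr' : c * r * c⁻¹ ∈ H) (hb' : c * b * c⁻¹ ∈ H) :
    conjSubgroup c G = H := by
  have h := hgen (G ⊓ Subgroup.comap (MulAut.conj c).toMonoidHom H) inf_le_left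
    ⟨hr, hr'⟩ ⟨hb, hb'⟩ (fun g hg => ⟨hg.1, hZ g hg⟩)
  refine Subgroup.eq_of_le_of_card_ge ?_ (by rw [card_conjSubgroup, hcard])
  exact Subgroup.map_le_iff_le_comap.mpr (h.trans inf_le_right)

lemma conj_eq_of_mem_center {Γ : Type*} [Group Γ] {c g : Γ} (h : g ∈ Subgroup.center Γ) :
    c * g * c⁻¹ = g := by
  rw [Subgroup.mem_center_iff.mp h c, mul_inv_cancel_right]

lemma det_val_ne_zero (g : GL (Fin 2) F) : g.val.det ≠ 0 :=
  ((Matrix.isUnit_iff_isUnit_det _).mp g.isUnit).ne_zero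

lemma IsSeparableGroup.trace_sq_ne {G : Subgroup (GL (Fin 2) F)} (hG : IsSeparableGroup G)
    {g : GL (Fin 2) F} (hg : g ∈ G) (hgc : g ∉ Subgroup.center (GL (Fin 2) F)) :
    g.val.trace ^ 2 ≠ 4 * g.val.det := fun h => hgc (hG g hg h)

lemma IsTopElement.centralizerIn_le_of_mem {G K : Subgroup (GL (Fin 2) F)} {r : GL (Fin 2) F}
    (h : IsTopElement G r) (hr : r ∈ K) (hZ : G ⊓ Subgroup.center (GL (Fin 2) F) ≤ K) :
    centralizerIn G r ≤ K :=
  fun _ hy => (mem_centralizerIn.mp (h.centralizerIn_le hr hZ hy)).1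

lemma IsTopElement.trace_eq_zero_of_card_eq [Finite F] {G : Subgroup (GL (Fin 2) F)}
    {r s : GL (Fin 2) F} (hr : IsTopElement G r) (hG : IsSeparableGroup G)
    (hc : Nat.card G = 2 * Nat.card (centralizerIn G r)) (hs : s ∈ G)
    (hsr : s ∉ centralizerIn G r) : s.val.trace = 0 ∧ (r.val * s.val).trace = 0 := by
  have hle : centralizerIn G r ≤ G := inf_le_left
  have hmem : s * r * s⁻¹ ∈ centralizerIn G r := by
    rw [mul_mem_iff_of_card_eq_two_mul hle hc (G.mul_mem hs hr.mem) (G.inv_mem hs),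
      mul_mem_iff_of_card_eq_two_mul hle hc hs hr.mem]
    have : r ∈ centralizerIn G r := mem_centralizerIn.mpr ⟨hr.mem, Commute.refl r⟩
    simp [hsr, this]
  exact trace_eq_zero_of_commute_conj (hG.trace_sq_ne hr.mem hr.notMem_center) hr.notMem_center
    (mem_centralizerIn.mp hmem).2 (fun h => hsr (mem_centralizerIn.mpr ⟨hs, h⟩))

lemma exists_conjSubgroup_eq_of_matched_reflections [Finite F] {G H : Subgroup (GL (Fin 2) F)}
    {r s s' : GL (Fin 2) F} (hrG : IsTopElement G r) (hrH : IsTopElement H r)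
    (hG : IsSeparableGroup G) (hH : IsSeparableGroup H) (h : detTraceSet G = detTraceSet H)
    (hcG : Nat.card G = 2 * Nat.card (centralizerIn G r))
    (hcH : Nat.card H = 2 * Nat.card (centralizerIn H r))
    (hs : s ∈ G) (hsr : s ∉ centralizerIn G r) (hs' : s' ∈ H) (hsr' : s' ∉ centralizerIn H r)
    (hd : s.val.det = s'.val.det) : ∃ c, conjSubgroup c G = H := by
  obtain ⟨t1, t2⟩ := hrG.trace_eq_zero_of_card_eq hG hcG hs hsr
  obtain ⟨t1', t2'⟩ := hrH.trace_eq_zero_of_card_eq hH hcH hs' hsr'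
  have hne : (r.val * s.val - s.val * r.val).det ≠ 0 := by
    rw [det_commutator_eq, t1, t2]
    have := mul_ne_zero (sub_ne_zero.mpr (hG.trace_sq_ne hrG.mem hrG.notMem_center))
      (det_val_ne_zero s)
    intro h0
    apply this
    linear_combination -h0
  obtain ⟨c, hc1, hc2⟩ := exists_conj_pair r s r s' rfl rfl hd (t1.trans t1'.symm)
    (t2.trans t2'.symm) (fun hsc => hrG.notMem_center ((mem_center_iff_isScalarMat r).mpr hsc)) hne
  refine ⟨c, conjSubgroup_eq_of_generated (r := r) (b := s)
    (Z := Subgroup.center (GL (Fin 2) F)) ?_ (fun K _ hrK hsK hZK g hg => ?_) hrG.mem hs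
    (fun g hg => ?_) (hc1.symm ▸ hrH.mem) (hc2.symm ▸ hs')⟩
  · rw [hcG, hcH, hrG.centralizerIn_eq hG hH h hrH.mem]
  · have hRK := hrG.centralizerIn_le_of_mem hrK hZK
    by_cases hgr : g ∈ centralizerIn G r
    · exact hRK hgr
    · have : s⁻¹ * g ∈ centralizerIn G r := by
        rw [mul_mem_iff_of_card_eq_two_mul (R := centralizerIn G r) inf_le_left hcG
          (G.inv_mem hs) hg]
        simp [hsr, hgr]
      exact (Subgroup.mul_mem_cancel_left _ (K.inv_mem hsK)).mp (hRK this)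
  · rw [conj_eq_of_mem_center hg.2]
    exact inf_center_le_of_detTraceSet_eq hH h hg

lemma exists_conjSubgroup_eq_of_card_eq_two_mul [Finite F] {G H : Subgroup (GL (Fin 2) F)}
    {r : GL (Fin 2) F} (hrG : IsTopElement G r) (hrH : IsTopElement H r)
    (hG : IsSeparableGroup G) (hH : IsSeparableGroup H) (h : detTraceSet G = detTraceSet H)
    (hcG : Nat.card G = 2 * Nat.card (centralizerIn G r))
    (hcH : Nat.card H = 2 * Nat.card (centralizerIn H r)) (h2 : (2 : F) ≠ 0) :
    ∃ c, conjSubgroup c G = H := by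
  have hex : ∀ K : Subgroup (GL (Fin 2) F), Nat.card K = 2 * Nat.card (centralizerIn K r) →
      ∃ s ∈ K, s ∉ centralizerIn K r := by
    intro K hK
    by_contra! hall
    have : K = centralizerIn K r := le_antisymm hall inf_le_left
    have hpos : 0 < Nat.card (centralizerIn K r) := Nat.card_pos
    have := congrArg (fun L : Subgroup (GL (Fin 2) F) => Nat.card L) this
    omega
  obtain ⟨s, hs, hsr⟩ := hex G hcG
  obtain ⟨s', hs', hsr'⟩ := hex H hcH
  obtain ⟨ts, -⟩ := hrG.trace_eq_zero_of_card_eq hG hcG hs hsr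
  obtain ⟨ts', -⟩ := hrH.trace_eq_zero_of_card_eq hH hcH hs' hsr'
  obtain ⟨x, hx, hxd, hxt⟩ := exists_mem_of_detTraceSet_eq h.symm hs'
  obtain ⟨x', hx', hxd', hxt'⟩ := exists_mem_of_detTraceSet_eq h hs
  by_cases hxr : x ∈ centralizerIn G r
  swap
  · exact exists_conjSubgroup_eq_of_matched_reflections hrG hrH hG hH h hcG hcH hx hxr hs' hsr' hxd
  by_cases hxr' : x' ∈ centralizerIn H r
  swap
  · exact exists_conjSubgroup_eq_of_matched_reflections hrG hrH hG hH h hcG hcH hs hsr hx' hxr'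
      hxd'.symm
  have hxc : x ∉ Subgroup.center (GL (Fin 2) F) := by
    intro hxc
    have := trace_sq_eq_of_mem_center hxc
    rw [hxt, ts'] at this
    have h4 : (4 : F) ≠ 0 := by
      rw [show (4 : F) = 2 * 2 by norm_num]
      exact mul_ne_zero h2 h2
    exact mul_ne_zero h4 (det_val_ne_zero x) (by linear_combination -this)
  have hxx : Commute x' x := commute_of_commute_noncentral hrG.notMem_center
    (mem_centralizerIn.mp hxr').2 (mem_centralizerIn.mp hxr).2.symm
  obtain ⟨α, β, hαβ⟩ := val_eq_of_commute hxc hxx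
  have hα : α = 0 := by
    have := congrArg Matrix.trace hαβ
    rw [trace_smul_one_add_smul, hxt, hxt', ts, ts'] at this
    have h0 : 2 * α = 0 := by linear_combination -this
    exact (mul_eq_zero.mp h0).resolve_left h2
  have hw : (x' * x⁻¹).val = β • (1 : Matrix (Fin 2) (Fin 2) F) := by
    rw [Units.val_mul, hαβ, hα, zero_smul, zero_add, smul_mul_assoc, ← Units.val_mul]
    simp
  have hwc : x' * x⁻¹ ∈ Subgroup.center (GL (Fin 2) F) := by
    rw [mem_center_iff_isScalarMat, hw]
    simp [IsScalarMat]
  have hwH : x' * x⁻¹ ∈ H := by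
    rw [hrG.centralizerIn_eq hG hH h hrH.mem] at hxr'
    exact inf_center_le_of_detTraceSet_eq hH h
      ⟨G.mul_mem (mem_centralizerIn.mp hxr').1 (G.inv_mem hx), hwc⟩
  refine exists_conjSubgroup_eq_of_matched_reflections hrG hrH hG hH h hcG hcH hs hsr
    (H.mul_mem hwH hs') (fun hm => hsr' (mem_centralizerIn.mpr ⟨hs', ?_⟩)) ?_
  · have h1 := (mem_centralizerIn.mp hm).2
    have h3 : Commute (x' * x⁻¹)⁻¹ r :=
      ((Subgroup.mem_center_iff.mp (Subgroup.inv_mem _ hwc)) r).symm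
    have := h3.mul_left h1
    rwa [inv_mul_cancel_left] at this
  · rw [Units.val_mul, Matrix.det_mul, ← hxd', ← hxd, ← Matrix.det_mul, ← Units.val_mul,
      inv_mul_cancel_right]

end Dihedral

section Polyhedral

variable {F : Type*} [Field F]

/-- The order and the largest centralizer of `G` are, relative to the order `z` of its subgroup
of scalars, as in a preimage of the tetrahedral, octahedral or icosahedral group. -/
def IsPolyhedral (G : Subgroup (GL (Fin 2) F)) (z n : ℕ) : Prop :=
  (n = 3 ∧ Nat.card G = z * 12) ∨ (n = 4 ∧ Nat.card G = z * 24) ∨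
    (n = 5 ∧ Nat.card G = z * 60 ∧ ∀ y ∈ G, y ∉ Subgroup.center (GL (Fin 2) F) →
      Nat.card (centralizerIn G y) = z * 5 ∨ Nat.card (centralizerIn G y) = z * 3 ∨
      Nat.card (centralizerIn G y) = z * 2)

lemma val_inv_eq (b : GL (Fin 2) F) : (b⁻¹).val =
    b.val.det⁻¹ • (b.val.trace • (1 : Matrix (Fin 2) (Fin 2) F) - b.val) := by
  rw [Matrix.coe_units_inv]
  apply Matrix.inv_eq_right_inv
  rw [mul_smul_comm, mul_sub, mul_smul_comm, mul_one, mul_self_eq, sub_sub_cancel, smul_smul,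
    inv_mul_cancel₀ (det_val_ne_zero b), one_smul]

lemma trace_mul_val_inv (r b : GL (Fin 2) F) : (r * b⁻¹).val.trace =
    (r.val.trace * b.val.trace - (r.val * b.val).trace) / b.val.det := by
  rw [Units.val_mul, val_inv_eq, mul_smul_comm, Matrix.trace_smul, mul_sub, Matrix.trace_sub,
    mul_smul_comm, mul_one, Matrix.trace_smul, smul_eq_mul, smul_eq_mul]
  ring

lemma det_val_inv (b : GL (Fin 2) F) : (b⁻¹).val.det = b.val.det⁻¹ := by
  rw [Matrix.coe_units_inv, Matrix.det_nonsing_inv, Ring.inverse_eq_inv']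

lemma trace_commutator (r b : GL (Fin 2) F) : (r * b * r⁻¹ * b⁻¹).val.trace =
    (r.val.trace ^ 2 * b.val.det + b.val.trace ^ 2 * r.val.det + (r.val * b.val).trace ^ 2
      - r.val.trace * b.val.trace * (r.val * b.val).trace - 2 * r.val.det * b.val.det)
      / (r.val.det * b.val.det) := by
  rw [Units.val_mul, Units.val_mul, Units.val_mul, val_inv_eq, val_inv_eq, mul_smul_comm,
    mul_smul_comm, smul_mul_assoc, Matrix.trace_smul, Matrix.trace_smul, smul_eq_mul, smul_eq_mul,
    ← mul_assoc, ← mul_inv, mul_comm b.val.det, div_eq_inv_mul]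
  congr 1
  simp [Matrix.det_fin_two, Matrix.trace_fin_two, Matrix.mul_apply, Fin.sum_univ_two]
  ring

lemma trace_mul_self_mul (r b : GL (Fin 2) F) : (r * r * b).val.trace =
    r.val.trace * (r.val * b.val).trace - r.val.det * b.val.trace := by
  rw [Units.val_mul, Units.val_mul, mul_self_eq, sub_mul, smul_mul_assoc, smul_mul_assoc, one_mul,
    Matrix.trace_sub, Matrix.trace_smul, Matrix.trace_smul, smul_eq_mul, smul_eq_mul]

lemma IsPolyhedral.allowedRatio [Finite F] {G : Subgroup (GL (Fin 2) F)} {r y : GL (Fin 2) F}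
    {z n : ℕ} (hP : IsPolyhedral G z n) (hr : IsTopElement G r)
    (hz : Nat.card (G ⊓ Subgroup.center (GL (Fin 2) F) : Subgroup (GL (Fin 2) F)) = z)
    (hn : Nat.card (centralizerIn G r) = z * n) (hy : y ∈ G)
    (hyc : y ∉ Subgroup.center (GL (Fin 2) F)) :
    AllowedRatio n (y.val.trace ^ 2 / y.val.det) := by
  obtain ⟨m, hm, hpow, -⟩ := exists_card_centralizerIn_eq hz hy
  have hz0 : 0 < z := hz ▸ Nat.card_pos
  have h2 := two_le_of_card_centralizerIn_eq hz hy hyc hm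
  have hle : m ≤ n := by
    have := hr.card_le y hy hyc
    rw [hm, hn] at this
    exact Nat.le_of_mul_le_mul_left this hz0
  refine allowedRatio_of_pow_mem_center hyc hpow ?_
  rcases hP with ⟨rfl, -⟩ | ⟨rfl, -⟩ | ⟨rfl, -, hl⟩
  · omega
  · omega
  · have := hl y hy hyc
    rw [hm, Nat.mul_right_inj hz0.ne', Nat.mul_right_inj hz0.ne', Nat.mul_right_inj hz0.ne'] at this
    omega

/-- The ratio of the squared trace to the determinant of a generator of a largest centralizer. -/
lemma IsPolyhedral.ratio_eq [Finite F] {G : Subgroup (GL (Fin 2) F)} {r : GL (Fin 2) F}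
    {z n : ℕ} (hP : IsPolyhedral G z n) (hr : IsTopElement G r)
    (hz : Nat.card (G ⊓ Subgroup.center (GL (Fin 2) F) : Subgroup (GL (Fin 2) F)) = z)
    (hn : Nat.card (centralizerIn G r) = z * n) {τ : F}
    (hτ : r.val.trace ^ 2 = τ * r.val.det) :
    r ^ n ∈ Subgroup.center (GL (Fin 2) F) ∧
      ((n = 3 ∧ τ = 1) ∨ (n = 4 ∧ τ = 2) ∨ (n = 5 ∧ τ ^ 2 - 3 * τ + 1 = 0)) := by
  obtain ⟨m, hm, hpow, hdvd⟩ := exists_card_centralizerIn_eq hz hr.mem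
  have hz0 : 0 < z := hz ▸ Nat.card_pos
  obtain rfl : m = n := Nat.eq_of_mul_eq_mul_left hz0 (hm.symm.trans hn)
  refine ⟨hpow, ?_⟩
  have hd := det_val_ne_zero r
  have e1 : (r ^ 1).val = (0 : F) • (1 : Matrix (Fin 2) (Fin 2) F) + (1 : F) • r.val := by simp
  have e2 := val_pow_succ e1
  have e3 := val_pow_succ e2
  have e4 := val_pow_succ e3
  have e5 := val_pow_succ e4
  rcases hP with ⟨rfl, -⟩ | ⟨rfl, -⟩ | ⟨rfl, -, -⟩
  · left
    have h0 := eq_zero_of_smul_add_smul_mem_center hr.notMem_center hpow e3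
    refine ⟨rfl, mul_right_cancel₀ hd ?_⟩
    linear_combination h0 - hτ
  · right; left
    have h0 := eq_zero_of_smul_add_smul_mem_center hr.notMem_center hpow e4
    have ht : r.val.trace ≠ 0 := fun ht => by
      have := hdvd hr 2 (sq_mem_center_of_trace_eq_zero ht)
      omega
    refine ⟨rfl, mul_right_cancel₀ hd (mul_left_cancel₀ ht ?_)⟩
    linear_combination h0 - r.val.trace * hτ
  · right; right
    have h0 := eq_zero_of_smul_add_smul_mem_center hr.notMem_center hpow e5
    refine ⟨rfl, (mul_eq_zero.mp ?_).resolve_right (pow_ne_zero 2 hd)⟩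
    linear_combination h0 - (r.val.trace ^ 2 + τ * r.val.det - 3 * r.val.det) * hτ

lemma IsPolyhedral.card_ne [Finite F] {G : Subgroup (GL (Fin 2) F)} {z n : ℕ}
    (hP : IsPolyhedral G z n) (hz0 : 0 < z) :
    Nat.card G ≠ z * n ∧ Nat.card G ≠ z * (2 * n) := by
  rcases hP with ⟨rfl, h⟩ | ⟨rfl, h⟩ | ⟨rfl, h, -⟩ <;> rw [h] <;> omega

lemma IsPolyhedral.exists_not_commute_conj [Finite F] {G : Subgroup (GL (Fin 2) F)}
    {r : GL (Fin 2) F} {z n : ℕ} (hP : IsPolyhedral G z n) (hr : IsTopElement G r)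
    (hG : IsSeparableGroup G)
    (hz : Nat.card (G ⊓ Subgroup.center (GL (Fin 2) F) : Subgroup (GL (Fin 2) F)) = z)
    (hn : Nat.card (centralizerIn G r) = z * n) :
    ∃ g ∈ G, ¬ Commute (g * r * g⁻¹) r := by
  by_contra! hall
  have hz0 : 0 < z := hz ▸ Nat.card_pos
  have h := hG.isTwistedCA.card_commNormalizer (x := ⟨r, hr.mem⟩) hr.notMem_center
  have huniv : commNormalizer (⟨r, hr.mem⟩ : G) = Set.univ := by
    ext g
    simp only [commNormalizer, Set.mem_univ, iff_true]
    have := hall g g.2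
    exact Subtype.ext this
  rw [huniv, Set.ncard_univ, ← card_centralizerIn, hn] at h
  have := hP.card_ne hz0
  rcases h with h | h
  · exact this.1 h
  · exact this.2 (by rw [h]; ring)

lemma commute_of_mul_mem_center {Γ : Type*} [Group Γ] {r u b : Γ} (hu : Commute u r)
    (h : u * b ∈ Subgroup.center Γ) : Commute b r := by
  have h1 : Commute (u * b) r := ((Subgroup.mem_center_iff.mp h) r).symm
  have := hu.inv_left.mul_left h1
  rwa [inv_mul_cancel_left] at this

end Polyhedral

section Partners

variable {F : Type*} [Field F]

lemma IsPolyhedral.natCast_ne_zero {G : Subgroup (GL (Fin 2) F)} {z n : ℕ}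
    (hP : IsPolyhedral G z n) (hF : (Nat.card G : F) ≠ 0) :
    (2 : F) ≠ 0 ∧ (3 : F) ≠ 0 ∧ (n = 5 → (5 : F) ≠ 0) := by
  have key : ∀ p k : ℕ, Nat.card G = p * k → (p : F) ≠ 0 := by
    intro p k h h0
    rw [h, Nat.cast_mul, h0, zero_mul] at hF
    exact hF rfl
  rcases hP with ⟨rfl, h⟩ | ⟨rfl, h⟩ | ⟨rfl, h, -⟩
  · refine ⟨?_, ?_, fun h => by omega⟩
    · exact_mod_cast key 2 (z * 6) (by rw [h]; ring)
    · exact_mod_cast key 3 (z * 4) (by rw [h]; ring)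
  · refine ⟨?_, ?_, fun h => by omega⟩
    · exact_mod_cast key 2 (z * 12) (by rw [h]; ring)
    · exact_mod_cast key 3 (z * 8) (by rw [h]; ring)
  · refine ⟨?_, ?_, fun _ => ?_⟩
    · exact_mod_cast key 2 (z * 30) (by rw [h]; ring)
    · exact_mod_cast key 3 (z * 20) (by rw [h]; ring)
    · exact_mod_cast key 5 (z * 12) (by rw [h]; ring)

/-- If `r` has odd order `n` modulo scalars and `r² b⁻¹` has trace zero, the group generated by
`r` and `b` contains the scalar `det r`. -/
lemma exists_scalar_mem {G : Subgroup (GL (Fin 2) F)} {r b : GL (Fin 2) F} {n : ℕ}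
    (hr : r ∈ G) (hb : b ∈ G) (hdet : b.val.det = r.val.det)
    (htr : (r * r * b⁻¹).val.trace = 0) (hn : n = 3 ∨ n = 5)
    (hpow : r ^ n ∈ Subgroup.center (GL (Fin 2) F)) :
    ∃ σ ∈ G, σ.val = r.val.det • (1 : Matrix (Fin 2) (Fin 2) F) := by
  have hd := det_val_ne_zero r
  let σ : GL (Fin 2) F := Matrix.GeneralLinearGroup.scalar (Fin 2) (Units.mk0 _ hd)
  have hσ : σ.val = r.val.det • (1 : Matrix (Fin 2) (Fin 2) F) := by
    rw [Matrix.GeneralLinearGroup.coe_scalar, Matrix.smul_one_eq_diagonal]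
    rfl
  set x := r * r * b⁻¹
  have hx : x ∈ G := G.mul_mem (G.mul_mem hr hr) (G.inv_mem hb)
  have hxd : x.val.det = r.val.det := by
    simp only [x, Units.val_mul, Matrix.det_mul, det_val_inv, hdet]
    field_simp
  have hσpow : ∀ k : ℕ, (σ ^ k).val = r.val.det ^ k • (1 : Matrix (Fin 2) (Fin 2) F) := by
    intro k
    rw [Units.val_pow_eq_pow_val, hσ, smul_pow, one_pow]
  have hxx : x.val * x.val = -(r.val.det • (1 : Matrix (Fin 2) (Fin 2) F)) := by
    rw [mul_self_eq, htr, hxd, zero_smul, zero_sub]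
  have hx4 : x ^ 4 = σ ^ 2 := by
    apply Units.ext
    rw [hσpow, show x ^ 4 = x * x * (x * x) by rw [← pow_two, ← pow_two, ← pow_mul], Units.val_mul,
      Units.val_mul, hxx, neg_mul_neg, smul_mul_smul_comm, one_mul, pow_two]
  have hrn : r ^ n * r ^ n = σ ^ n := by
    have hdetn : (r ^ n).val.det = r.val.det ^ n := by
      rw [Units.val_pow_eq_pow_val, Matrix.det_pow]
    obtain ⟨h1, h2, h3⟩ := (mem_center_iff_isScalarMat _).mp hpow
    apply Units.ext
    rw [hσpow, Units.val_mul, ← hdetn]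
    generalize (r ^ n).val = w at h1 h2 h3
    ext i j
    fin_cases i <;> fin_cases j <;>
      simp [Matrix.mul_apply, Fin.sum_univ_two, Matrix.det_fin_two, h1, h2, h3]
  have hm2 : σ ^ 2 ∈ G := hx4 ▸ G.pow_mem hx 4
  have hmn : σ ^ n ∈ G := hrn ▸ G.mul_mem (G.pow_mem hr n) (G.pow_mem hr n)
  refine ⟨σ, ?_, hσ⟩
  rcases hn with rfl | rfl
  · rw [show σ = σ ^ 3 * (σ ^ 2)⁻¹ by group]
    exact G.mul_mem hmn (G.inv_mem hm2)
  · rw [show σ = σ ^ 5 * (σ ^ 2 * σ ^ 2)⁻¹ by group]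
    exact G.mul_mem hmn (G.inv_mem (G.mul_mem hm2 hm2))

lemma IsPolyhedral.exists_partner [Finite F] {G : Subgroup (GL (Fin 2) F)} {r : GL (Fin 2) F}
    {z n : ℕ} (hP : IsPolyhedral G z n) (hr : IsTopElement G r) (hG : IsSeparableGroup G)
    (hz : Nat.card (G ⊓ Subgroup.center (GL (Fin 2) F) : Subgroup (GL (Fin 2) F)) = z)
    (hn : Nat.card (centralizerIn G r) = z * n) (hF : (Nat.card G : F) ≠ 0) :
    ∃ b ∈ G, b.val.trace = r.val.trace ∧ b.val.det = r.val.det ∧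
      (r.val * b.val).trace = r.val.det := by
  obtain ⟨h2, h3, h5⟩ := hP.natCast_ne_zero hF
  obtain ⟨g, hg, hgr⟩ := hP.exists_not_commute_conj hr hG hz hn
  have hd := det_val_ne_zero r
  obtain ⟨τ, hτ⟩ : ∃ τ, r.val.trace ^ 2 = τ * r.val.det :=
    ⟨r.val.trace ^ 2 / r.val.det, (div_mul_cancel₀ _ hd).symm⟩
  obtain ⟨hpow, hτn⟩ := hP.ratio_eq hr hz hn hτ
  have hbt := trace_conj_val g r
  have hbd := det_conj_val g r
  have hb : g * r * g⁻¹ ∈ G := G.mul_mem (G.mul_mem hg hr.mem) (G.inv_mem hg)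
  generalize g * r * g⁻¹ = b at *
  obtain ⟨p, hp⟩ : ∃ p, (r.val * b.val).trace = p * r.val.det :=
    ⟨(r.val * b.val).trace / r.val.det, (div_mul_cancel₀ _ hd).symm⟩
  have ht : r.val.trace ≠ 0 := by
    intro ht
    rw [ht] at hτ
    have hτ0 : τ = 0 := by
      have : τ * r.val.det = 0 := by rw [← hτ]; ring
      exact (mul_eq_zero.mp this).resolve_right hd
    rw [hτ0] at hτn
    rcases hτn with ⟨-, h⟩ | ⟨-, h⟩ | ⟨-, h⟩
    · exact zero_ne_one h
    · exact h2 h.symm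
    · norm_num at h
  have ratio : ∀ y ∈ G, y ∉ Subgroup.center (GL (Fin 2) F) → ∀ x,
      y.val.trace ^ 2 = x * y.val.det → AllowedRatio n x := by
    intro y hy hyc x hx
    have := hP.allowedRatio hr hz hn hy hyc
    rwa [hx, mul_div_cancel_right₀ _ (det_val_ne_zero y)] at this
  have e1 : AllowedRatio n (p ^ 2) := by
    refine ratio (r * b) (G.mul_mem hr.mem hb)
      (fun h => hgr (commute_of_mul_mem_center (Commute.refl r) h)) _ ?_
    rw [Units.val_mul, hp, Matrix.det_mul, hbd]
    ring
  have htinv : (r * b⁻¹).val.trace = τ - p := by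
    rw [trace_mul_val_inv, hbt, hbd, hp, ← pow_two, hτ]
    field_simp
  have e2 : AllowedRatio n ((τ - p) ^ 2) := by
    refine ratio (r * b⁻¹) (G.mul_mem hr.mem (G.inv_mem hb))
      (fun h => hgr ?_) _ ?_
    · simpa using (commute_of_mul_mem_center (Commute.refl r) h).inv_left
    · rw [htinv, Units.val_mul, Matrix.det_mul, det_val_inv, hbd, mul_inv_cancel₀ hd, mul_one]
  have e3 : AllowedRatio n ((2 * τ + p ^ 2 - τ * p - 2) ^ 2) := by
    refine ratio (r * b * r⁻¹ * b⁻¹)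
      (G.mul_mem (G.mul_mem (G.mul_mem hr.mem hb) (G.inv_mem hr.mem)) (G.inv_mem hb))
      (fun h => ?_) _ ?_
    · have h1 : Commute (b * r⁻¹ * b⁻¹) r :=
        commute_of_mul_mem_center (u := r) (Commute.refl r) (by simpa only [mul_assoc] using h)
      have h3 : Commute (b * r * b⁻¹) r := by
        have := h1.inv_left
        simpa [mul_assoc] using this
      have := (trace_eq_zero_of_commute_conj (hG.trace_sq_ne hr.mem hr.notMem_center)
        hr.notMem_center h3 hgr).1
      exact ht (hbt ▸ this)
    · have hdet : (r * b * r⁻¹ * b⁻¹).val.det = 1 := by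
        simp only [Units.val_mul, Matrix.det_mul, det_val_inv, hbd]
        field_simp
      rw [hdet, mul_one, trace_commutator, hbt, hbd, hp]
      congr 1
      rw [div_eq_iff (mul_ne_zero hd hd)]
      linear_combination (2 * r.val.det - p * r.val.det) * hτ
  have e4 : AllowedRatio n (τ * (p - 1) ^ 2) := by
    refine ratio (r * r * b) (G.mul_mem (G.mul_mem hr.mem hr.mem) hb)
      (fun h => hgr (commute_of_mul_mem_center
        ((Commute.refl r).mul_left (Commute.refl r)) h)) _ ?_
    rw [trace_mul_self_mul, Units.val_mul, Units.val_mul, Matrix.det_mul, Matrix.det_mul, hp, hbd,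
      hbt]
    linear_combination (p - 1) ^ 2 * r.val.det ^ 2 * hτ
  have hcases : p = 1 ∨ (p = τ - 1 ∧ (n = 3 ∨ n = 5)) := by
    rcases hτn with ⟨rfl, rfl⟩ | ⟨rfl, rfl⟩ | ⟨rfl, hτ5⟩
    · rcases tetrahedral_ratio h2 h3 e1 e2 with h | h
      · exact Or.inl h
      · exact Or.inr ⟨by rw [h, sub_self], Or.inl rfl⟩
    · exact Or.inl (octahedral_ratio h2 h3 e1 e2 e3)
    · rcases icosahedral_ratio h2 h3 (h5 rfl) hτ5 e1 e2 e4 with h | h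
      · exact Or.inl h
      · exact Or.inr ⟨h, Or.inr rfl⟩
  rcases hcases with rfl | ⟨hpτ, hn35⟩
  · exact ⟨b, hb, hbt, hbd, by rw [hp, one_mul]⟩
  · have htr0 : (r * r * b⁻¹).val.trace = 0 := by
      have hbi : (b⁻¹).val.trace = r.val.trace / r.val.det := by
        have := trace_mul_val_inv 1 b
        rw [one_mul, Units.val_one, one_mul, Matrix.trace_one, hbt, hbd] at this
        rw [this]
        simp
        ring
      rw [trace_mul_self_mul, ← Units.val_mul, htinv, hpτ, hbi]
      field_simp
      ring
    obtain ⟨σ, hσ, hσv⟩ := exists_scalar_mem hr.mem hb hbd htr0 hn35 hpow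
    have hval : (σ * b⁻¹).val = r.val.trace • (1 : Matrix (Fin 2) (Fin 2) F) - b.val := by
      rw [Units.val_mul, hσv, val_inv_eq, hbd, hbt, smul_mul_smul_comm, mul_inv_cancel₀ hd,
        one_smul, one_mul]
    refine ⟨σ * b⁻¹, G.mul_mem hσ (G.inv_mem hb), ?_, ?_, ?_⟩
    · rw [hval, Matrix.trace_sub, Matrix.trace_smul, Matrix.trace_one, hbt]
      simp
      ring
    · rw [Units.val_mul, Matrix.det_mul, hσv, det_val_inv, hbd, Matrix.det_smul, Matrix.det_one]
      simp
      field_simp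
    · rw [hval, mul_sub, Matrix.trace_sub, mul_smul_comm, mul_one, Matrix.trace_smul, smul_eq_mul,
        hp, hpτ, ← pow_two, hτ]
      ring

end Partners

section Comparison

variable {F : Type*} [Field F]

lemma IsPolyhedral.le_of_mem [Finite F] {G K : Subgroup (GL (Fin 2) F)} {r b : GL (Fin 2) F}
    {z n : ℕ} (hP : IsPolyhedral G z n) (hr : IsTopElement G r) (hG : IsSeparableGroup G)
    (hz : Nat.card (G ⊓ Subgroup.center (GL (Fin 2) F) : Subgroup (GL (Fin 2) F)) = z)
    (hn : Nat.card (centralizerIn G r) = z * n) (hbr : ¬ Commute b r) (hbt : b.val.trace ≠ 0)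
    (hKG : K ≤ G) (hrK : r ∈ K) (hbK : b ∈ K) (hZK : G ⊓ Subgroup.center (GL (Fin 2) F) ≤ K) :
    G ≤ K := by
  have hz0 : 0 < z := hz ▸ Nat.card_pos
  have hC : centralizerIn K r = centralizerIn G r := by
    refine le_antisymm (fun y hy => ?_) (hr.centralizerIn_le hrK hZK)
    obtain ⟨h1, h2⟩ := mem_centralizerIn.mp hy
    exact mem_centralizerIn.mpr ⟨hKG h1, h2⟩
  have hrtop : IsTopElement K r := by
    refine ⟨hrK, hr.notMem_center, fun y hy hyc => ?_, fun y hy => hr.exists_zpow y (hC ▸ hy)⟩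
    rw [hC]
    refine le_trans (Nat.card_le_card_of_injective
      (Subgroup.inclusion (show centralizerIn K y ≤ centralizerIn G y from fun w hw => ?_))
      (Subgroup.inclusion_injective _)) (hr.card_le y (hKG hy) hyc)
    obtain ⟨h1, h2⟩ := mem_centralizerIn.mp hw
    exact mem_centralizerIn.mpr ⟨hKG h1, h2⟩
  have hKs := hG.mono hKG
  have hzK : Nat.card (K ⊓ Subgroup.center (GL (Fin 2) F) : Subgroup (GL (Fin 2) F)) = z := by
    rw [← hz, le_antisymm (inf_le_inf_right _ hKG) (le_inf hZK inf_le_right)]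
  have hbC : b ∉ centralizerIn K r := fun h => hbr (mem_centralizerIn.mp h).2
  obtain ⟨n', -, h1, h2⟩ := hrtop.card_cases hKs hzK
  obtain rfl : n' = n := by
    rw [hC, hn] at h1
    exact (Nat.eq_of_mul_eq_mul_left hz0 h1).symm
  rcases h2 with h2 | h2 | h2
  · exfalso
    apply hbC
    have : centralizerIn K r = K := Subgroup.eq_of_le_of_card_ge inf_le_left (by rw [h1, h2])
    rwa [this]
  · exact absurd (hrtop.trace_eq_zero_of_card_eq hKs (by rw [h1, h2]; ring) hbK hbC).1 hbt
  · refine (Subgroup.eq_of_le_of_card_ge hKG ?_).ge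
    rcases hP with ⟨rfl, h⟩ | ⟨rfl, h⟩ | ⟨rfl, h, -⟩ <;> rw [h] <;> omega

lemma IsPolyhedral.exists_conjSubgroup_eq [Finite F] {G H : Subgroup (GL (Fin 2) F)}
    {r : GL (Fin 2) F} {z n : ℕ} (hPG : IsPolyhedral G z n) (hPH : IsPolyhedral H z n)
    (hrG : IsTopElement G r) (hrH : IsTopElement H r)
    (hG : IsSeparableGroup G) (hH : IsSeparableGroup H) (h : detTraceSet G = detTraceSet H)
    (hz : Nat.card (G ⊓ Subgroup.center (GL (Fin 2) F) : Subgroup (GL (Fin 2) F)) = z)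
    (hn : Nat.card (centralizerIn G r) = z * n) (hF : (Nat.card G : F) ≠ 0) :
    ∃ c, conjSubgroup c G = H := by
  have hcard : Nat.card G = Nat.card H := by
    rcases hPG with ⟨rfl, h1⟩ | ⟨rfl, h1⟩ | ⟨rfl, h1, -⟩ <;>
    rcases hPH with ⟨h0, h2⟩ | ⟨h0, h2⟩ | ⟨h0, h2, -⟩ <;> omega
  obtain ⟨h2, h3, -⟩ := hPG.natCast_ne_zero hF
  have hd := det_val_ne_zero r
  obtain ⟨b, hb, hbt, hbd, hrb⟩ := hPG.exists_partner hrG hG hz hn hF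
  obtain ⟨b', hb', hbt', hbd', hrb'⟩ := hPH.exists_partner hrH hH
    ((inf_center_eq_of_detTraceSet_eq hG hH h) ▸ hz)
    ((hrG.centralizerIn_eq hG hH h hrH.mem) ▸ hn) (hcard ▸ hF)
  obtain ⟨τ, hτ⟩ : ∃ τ, r.val.trace ^ 2 = τ * r.val.det :=
    ⟨r.val.trace ^ 2 / r.val.det, (div_mul_cancel₀ _ hd).symm⟩
  have hτn := (hPG.ratio_eq hrG hz hn hτ).2
  have hτ0 : τ ≠ 0 ∧ 3 - τ ≠ 0 := by
    rcases hτn with ⟨-, rfl⟩ | ⟨-, rfl⟩ | ⟨-, h⟩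
    · refine ⟨one_ne_zero, ?_⟩
      rw [show (3 : F) - 1 = 2 by norm_num]
      exact h2
    · refine ⟨h2, ?_⟩
      rw [show (3 : F) - 2 = 1 by norm_num]
      exact one_ne_zero
    · have : τ * (3 - τ) = 1 := by linear_combination -h
      exact mul_ne_zero_iff.mp (this ▸ one_ne_zero)
  have hne : (r.val * b.val - b.val * r.val).det ≠ 0 := by
    rw [det_commutator_eq, hbt, hbd, hrb]
    have : 4 * r.val.det * r.val.det - r.val.trace ^ 2 * r.val.det - r.val.trace ^ 2 * r.val.det
        - r.val.det ^ 2 + r.val.trace * r.val.trace * r.val.det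
        = r.val.det ^ 2 * (3 - τ) := by linear_combination -r.val.det * hτ
    rw [this]
    exact mul_ne_zero (pow_ne_zero 2 hd) hτ0.2
  have hbr : ¬ Commute b r := by
    intro hcomm
    apply hne
    rw [← Units.val_mul, ← Units.val_mul, hcomm.eq, sub_self, Matrix.det_zero]
  have hbt0 : b.val.trace ≠ 0 := by
    intro h0
    rw [hbt] at h0
    rw [h0] at hτ
    exact mul_ne_zero hτ0.1 hd (by rw [← hτ]; ring)
  obtain ⟨c, hc1, hc2⟩ := exists_conj_pair r b r b' rfl rfl (hbd.trans hbd'.symm)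
    (hbt.trans hbt'.symm) (hrb.trans hrb'.symm)
    (fun hsc => hrG.notMem_center ((mem_center_iff_isScalarMat r).mpr hsc)) hne
  refine ⟨c, conjSubgroup_eq_of_generated (r := r) (b := b)
    (Z := Subgroup.center (GL (Fin 2) F)) hcard (fun K hKG hrK hbK hZK => ?_) hrG.mem hb
    (fun g hg => ?_) (hc1.symm ▸ hrH.mem) (hc2.symm ▸ hb')⟩
  · exact hPG.le_of_mem hrG hG hz hn hbr hbt0 hKG hrK hbK hZK
  · rw [conj_eq_of_mem_center hg.2]
    exact inf_center_le_of_detTraceSet_eq hH h hg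

/-- A polyhedral group contains an element with a determinant and trace that do not occur in the
centralizer of its top element. -/
lemma IsPolyhedral.detTraceSet_ne [Finite F] {G H : Subgroup (GL (Fin 2) F)}
    {r : GL (Fin 2) F} {z n : ℕ} (hPH : IsPolyhedral H z n)
    (hrG : IsTopElement G r) (hrH : IsTopElement H r)
    (hG : IsSeparableGroup G) (hH : IsSeparableGroup H)
    (hz : Nat.card (G ⊓ Subgroup.center (GL (Fin 2) F) : Subgroup (GL (Fin 2) F)) = z)
    (hn : Nat.card (centralizerIn G r) = z * n) (hcG : Nat.card G = z * n)
    (hF : (Nat.card H : F) ≠ 0) : detTraceSet G ≠ detTraceSet H := by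
  intro h
  obtain ⟨h2, h3, -⟩ := hPH.natCast_ne_zero hF
  have hzH : Nat.card (H ⊓ Subgroup.center (GL (Fin 2) F) : Subgroup (GL (Fin 2) F)) = z :=
    (inf_center_eq_of_detTraceSet_eq hG hH h) ▸ hz
  have hnH : Nat.card (centralizerIn H r) = z * n :=
    (hrG.centralizerIn_eq hG hH h hrH.mem) ▸ hn
  obtain ⟨b, hb, hbt, hbd, hrb⟩ := hPH.exists_partner hrH hH hzH hnH hF
  have hd := det_val_ne_zero r
  obtain ⟨τ, hτ⟩ : ∃ τ, r.val.trace ^ 2 = τ * r.val.det :=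
    ⟨r.val.trace ^ 2 / r.val.det, (div_mul_cancel₀ _ hd).symm⟩
  have hτn := (hPH.ratio_eq hrH hzH hnH hτ).2
  have hpow : r ^ n ∈ Subgroup.center (GL (Fin 2) F) := (hPH.ratio_eq hrH hzH hnH hτ).1
  have hGC : centralizerIn G r = G := Subgroup.eq_of_le_of_card_ge inf_le_left (by rw [hn, hcG])
  have hpowG : ∀ y ∈ G, y ^ n ∈ Subgroup.center (GL (Fin 2) F) := by
    intro y hy
    have hyC : y ∈ centralizerIn G r := hGC.symm ▸ hy
    obtain ⟨k, hk⟩ := hrG.exists_zpow y hyC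
    have hcomm : Commute (r ^ k) y := ((mem_centralizerIn.mp hyC).2.symm).zpow_left k
    have h1 := Subgroup.pow_mem _ hk n
    rw [hcomm.mul_pow] at h1
    have h4 : (r ^ k) ^ n ∈ Subgroup.center (GL (Fin 2) F) := by
      rw [← zpow_natCast, zpow_comm, zpow_natCast]
      exact Subgroup.zpow_mem _ hpow k
    exact (Subgroup.mul_mem_cancel_left _ h4).mp h1
  have hcop : ∀ (y : GL (Fin 2) F) (j : ℕ), Nat.Coprime j n → y ∈ G →
      y ^ j ∈ Subgroup.center (GL (Fin 2) F) → y ∈ Subgroup.center (GL (Fin 2) F) := by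
    intro y j hj hy h1
    have h4 := hpowG y hy
    have hbez := Nat.gcd_eq_gcd_ab j n
    rw [hj] at hbez
    have : y = (y ^ j) ^ (Nat.gcdA j n) * (y ^ n) ^ (Nat.gcdB j n) := by
      rw [← zpow_natCast y j, ← zpow_natCast y n, ← _root_.zpow_mul, ← _root_.zpow_mul,
          ← _root_.zpow_add, ← hbez]
      simp
    rw [this]
    exact Subgroup.mul_mem _ (Subgroup.zpow_mem _ h1 _) (Subgroup.zpow_mem _ h4 _)
  have h4 : (4 : F) ≠ 0 := by
    rw [show (4 : F) = 2 * 2 by norm_num]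
    exact mul_ne_zero h2 h2
  rcases hτn with ⟨rfl, rfl⟩ | hτn
  · obtain ⟨y, hy, hyd, hyt⟩ := exists_mem_of_detTraceSet_eq h.symm
      (H.mul_mem hrH.mem (H.inv_mem hb))
    rw [trace_mul_val_inv, hbt, hrb, hbd, ← pow_two, hτ, one_mul, sub_self, zero_div] at hyt
    have hyc := hcop y 2 (by norm_num) hy (sq_mem_center_of_trace_eq_zero hyt)
    have := trace_sq_eq_of_mem_center hyc
    rw [hyt] at this
    exact mul_ne_zero h4 (det_val_ne_zero y) (by linear_combination -this)
  · obtain ⟨y, hy, hyd, hyt⟩ := exists_mem_of_detTraceSet_eq h.symm (H.mul_mem hrH.mem hb)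
    rw [Units.val_mul] at hyd hyt
    rw [hrb] at hyt
    rw [Matrix.det_mul, hbd] at hyd
    have hysq : y.val.trace ^ 2 = y.val.det := by rw [hyd, hyt, pow_two]
    have hyc := hcop y 3 (by rcases hτn with ⟨rfl, -⟩ | ⟨rfl, -⟩ <;> norm_num) hy
      (pow_three_mem_center_of_trace_sq_eq hysq)
    have := trace_sq_eq_of_mem_center hyc
    rw [hysq] at this
    exact mul_ne_zero h3 (det_val_ne_zero y) (by linear_combination -this)

lemma exists_conjSubgroup_eq_of_isTopElement [Finite F] {G H : Subgroup (GL (Fin 2) F)}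
    {r : GL (Fin 2) F} (hrG : IsTopElement G r) (hrH : IsTopElement H r)
    (hG : IsSeparableGroup G) (hH : IsSeparableGroup H)
    (hFG : (Nat.card G : F) ≠ 0) (hFH : (Nat.card H : F) ≠ 0) (h : detTraceSet G = detTraceSet H)
    (hiff : Nat.card G = 2 * Nat.card (centralizerIn G r) ↔
      Nat.card H = 2 * Nat.card (centralizerIn H r)) : ∃ c, conjSubgroup c G = H := by
  have hC := hrG.centralizerIn_eq hG hH h hrH.mem
  have hZ := inf_center_eq_of_detTraceSet_eq hG hH h
  by_cases hcG : Nat.card G = 2 * Nat.card (centralizerIn G r)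
  · refine exists_conjSubgroup_eq_of_card_eq_two_mul hrG hrH hG hH h hcG (hiff.mp hcG) ?_
    intro h2
    rw [hcG, Nat.cast_mul, Nat.cast_two, h2, zero_mul] at hFG
    exact hFG rfl
  have hcH := fun hh => hcG (hiff.mpr hh)
  obtain ⟨n, -, hn, hcasesG⟩ := hrG.card_cases hG rfl
  obtain ⟨n', -, hn', hcasesH⟩ := hrH.card_cases hH rfl
  rw [← hZ] at hn' hcasesH
  set z := Nat.card (G ⊓ Subgroup.center (GL (Fin 2) F) : Subgroup (GL (Fin 2) F)) with hz
  obtain rfl : n = n' := by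
    rw [hC, hn] at hn'
    exact Nat.eq_of_mul_eq_mul_left Nat.card_pos hn'
  have hcasesG' : Nat.card G = z * n ∨ IsPolyhedral G z n := by
    rcases hcasesG with h1 | h1 | h1
    · exact Or.inl h1
    · exact absurd (by rw [h1, hn]; ring) hcG
    · exact Or.inr h1
  have hcasesH' : Nat.card H = z * n ∨ IsPolyhedral H z n := by
    rcases hcasesH with h1 | h1 | h1
    · exact Or.inl h1
    · exact absurd (by rw [h1, hn']; ring) hcH
    · exact Or.inr h1
  rcases hcasesG' with h1 | h1 <;> rcases hcasesH' with h2 | h2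
  · refine ⟨1, ?_⟩
    have e1 : centralizerIn G r = G := Subgroup.eq_of_le_of_card_ge inf_le_left (by rw [hn, h1])
    have e2 : centralizerIn H r = H := Subgroup.eq_of_le_of_card_ge inf_le_left (by rw [hn', h2])
    rw [conjSubgroup_one, ← e1, ← e2, hC]
  · exact absurd h (h2.detTraceSet_ne hrG hrH hG hH hz.symm hn h1 hFH)
  · exact absurd h.symm (h1.detTraceSet_ne hrH hrG hH hG (hZ ▸ hz.symm) hn' h2 hFG)
  · exact h1.exists_conjSubgroup_eq h2 hrG hrH hG hH h hz.symm hn hFG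

/-- Among three separable groups of order prime to the characteristic with the same determinants
and traces, two are conjugate. -/
lemma exists_conjSubgroup_eq_of_three [Finite F] {G H K : Subgroup (GL (Fin 2) F)}
    (hG : IsSeparableGroup G) (hH : IsSeparableGroup H) (hK : IsSeparableGroup K)
    (hFG : (Nat.card G : F) ≠ 0) (hFH : (Nat.card H : F) ≠ 0) (hFK : (Nat.card K : F) ≠ 0)
    (hGH : detTraceSet G = detTraceSet H) (hGK : detTraceSet G = detTraceSet K) :
    (∃ c, conjSubgroup c G = H) ∨ (∃ c, conjSubgroup c G = K) ∨ (∃ c, conjSubgroup c H = K) := by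
  by_cases hc : G ≤ Subgroup.center (GL (Fin 2) F)
  · left
    refine ⟨1, ?_⟩
    rw [conjSubgroup_one]
    have hHc : H ≤ Subgroup.center (GL (Fin 2) F) := by
      intro x hx
      obtain ⟨y, hy, hd, ht⟩ := exists_mem_of_detTraceSet_eq hGH.symm hx
      refine hH x hx ?_
      rw [← hd, ← ht]
      exact trace_sq_eq_of_mem_center (hc hy)
    have := inf_center_eq_of_detTraceSet_eq hG hH hGH
    rwa [inf_eq_left.mpr hc, inf_eq_left.mpr hHc] at this
  obtain ⟨r, hr⟩ := exists_isTopElement hG hc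
  obtain ⟨a, ha⟩ := hr.exists_conjSubgroup hG hH hGH
  obtain ⟨b, hb⟩ := hr.exists_conjSubgroup hG hK hGK
  have hGH' : detTraceSet G = detTraceSet (conjSubgroup a H) :=
    hGH.trans (detTraceSet_conjSubgroup a H).symm
  have hGK' : detTraceSet G = detTraceSet (conjSubgroup b K) :=
    hGK.trans (detTraceSet_conjSubgroup b K).symm
  have hFH' : (Nat.card (conjSubgroup a H) : F) ≠ 0 := by rwa [card_conjSubgroup]
  have hFK' : (Nat.card (conjSubgroup b K) : F) ≠ 0 := by rwa [card_conjSubgroup]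
  have back : ∀ {L M : Subgroup (GL (Fin 2) F)} {d : GL (Fin 2) F},
      (∃ c, conjSubgroup c L = conjSubgroup d M) → ∃ c, conjSubgroup c L = M := by
    rintro L M d ⟨c, hc⟩
    refine ⟨d⁻¹ * c, ?_⟩
    rw [← conjSubgroup_conjSubgroup, hc, conjSubgroup_conjSubgroup, inv_mul_cancel,
      conjSubgroup_one]
  have hGH2 := exists_conjSubgroup_eq_of_isTopElement hr ha hG (hH.conj a) hFG hFH' hGH'
  have hGK2 := exists_conjSubgroup_eq_of_isTopElement hr hb hG (hK.conj b) hFG hFK' hGK'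
  have hHK2 := exists_conjSubgroup_eq_of_isTopElement ha hb (hH.conj a) (hK.conj b) hFH' hFK'
    (hGH'.symm.trans hGK')
  by_cases h1 : Nat.card G = 2 * Nat.card (centralizerIn G r) ↔
      Nat.card (conjSubgroup a H) = 2 * Nat.card (centralizerIn (conjSubgroup a H) r)
  · exact Or.inl (back (hGH2 h1))
  by_cases h2 : Nat.card G = 2 * Nat.card (centralizerIn G r) ↔
      Nat.card (conjSubgroup b K) = 2 * Nat.card (centralizerIn (conjSubgroup b K) r)
  · exact Or.inr (Or.inl (back (hGK2 h2)))
  obtain ⟨c, hc⟩ := back (hHK2 ((not_iff.mp h1).symm.trans (not_iff.mp h2)))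
  refine Or.inr (Or.inr ⟨c * a, ?_⟩)
  rw [← conjSubgroup_conjSubgroup, hc]

end Comparison

section Signatures

variable {ℓ : ℕ} [Fact (Nat.Prime ℓ)]

lemma dimOne_eq_two_iff {g : GL2 ℓ} : dimOne g = 2 ↔ g = 1 := by
  have hfin : Module.finrank (ZMod ℓ) (Fin 2 → ZMod ℓ) = 2 := by simp
  constructor
  · intro h
    have htop : LinearMap.ker (Matrix.toLin' (mat g - 1)) = ⊤ :=
      Submodule.eq_top_of_finrank_eq (by rw [hfin]; exact h)
    rw [LinearMap.ker_eq_top, LinearEquiv.map_eq_zero_iff, sub_eq_zero] at htop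
    exact Units.ext htop
  · rintro rfl
    have : mat (1 : GL2 ℓ) - 1 = 0 := sub_self _
    rw [dimOne, this, map_zero, LinearMap.ker_zero, finrank_top, hfin]

lemma exists_mem_of_sigSet_eq {G H : Subgroup (GL2 ℓ)} (h : sigSet G = sigSet H) {g : GL2 ℓ}
    (hg : g ∈ G) : ∃ k ∈ H, k.val.det = g.val.det ∧ k.val.trace = g.val.trace ∧
      (k = 1 ↔ g = 1) := by
  have hmem : sigOf g ∈ sigSet H := h ▸ ⟨g, hg, rfl⟩
  obtain ⟨k, hk, e⟩ := hmem
  refine ⟨k, hk, congrArg Prod.fst e, congrArg (fun p => p.2.1) e, ?_⟩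
  have : dimOne k = dimOne g := congrArg (fun p => p.2.2) e
  rw [← dimOne_eq_two_iff, ← dimOne_eq_two_iff, this]

lemma detTraceSet_eq_of_sigSet_eq {G H : Subgroup (GL2 ℓ)} (h : sigSet G = sigSet H) :
    detTraceSet G = detTraceSet H := by
  have key : ∀ {G H : Subgroup (GL2 ℓ)}, sigSet G = sigSet H → detTraceSet G ⊆ detTraceSet H := by
    rintro G H h p ⟨g, hg, rfl⟩
    obtain ⟨k, hk, hd, ht, -⟩ := exists_mem_of_sigSet_eq h hg
    exact ⟨k, hk, by simp only [hd, ht]⟩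
  exact (key h).antisymm (key h.symm)

/-- `G` contains no nontrivial unipotent element. -/
def NoUnipotent (G : Subgroup (GL2 ℓ)) : Prop :=
  ∀ g ∈ G, g.val.det = 1 → g.val.trace = 2 → g = 1

lemma NoUnipotent.of_sigSet_eq {G H : Subgroup (GL2 ℓ)} (hG : NoUnipotent G)
    (h : sigSet G = sigSet H) : NoUnipotent H := by
  intro x hx hd ht
  obtain ⟨g, hg, hgd, hgt, hone⟩ := exists_mem_of_sigSet_eq h.symm hx
  exact hone.mp (hG g hg (hgd.trans hd) (hgt.trans ht))

lemma NoUnipotent.isSeparableGroup {G : Subgroup (GL2 ℓ)} (hG : NoUnipotent G) :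
    IsSeparableGroup G := by
  intro g hg h
  have hd := det_val_ne_zero g
  by_cases h2 : (2 : ZMod ℓ) = 0
  · have h4 : (4 : ZMod ℓ) = 0 := by
      rw [show (4 : ZMod ℓ) = 2 * 2 by norm_num, h2, zero_mul]
    have hℓ : ℓ = 2 := by
      have : ((2 : ℕ) : ZMod ℓ) = 0 := by exact_mod_cast h2
      exact (Nat.prime_dvd_prime_iff_eq Fact.out Nat.prime_two).mp
        ((ZMod.natCast_eq_zero_iff _ _).mp this)
    subst hℓ
    have ht : g.val.trace = 2 := by
      rw [h4, zero_mul] at h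
      rw [h2]
      exact (pow_eq_zero_iff two_ne_zero).mp h
    have hdet : g.val.det = 1 := by
      have := ZMod.pow_card_sub_one_eq_one hd
      simpa using this
    rw [hG g hg hdet ht]
    exact Subgroup.one_mem _
  · set l : ZMod ℓ := g.val.trace / 2
    have ht : g.val.trace = 2 * l := by
      simp only [l]
      field_simp
    have hdl : g.val.det = l ^ 2 := by
      have h4 : (4 : ZMod ℓ) ≠ 0 := by
        rw [show (4 : ZMod ℓ) = 2 * 2 by norm_num]
        exact mul_ne_zero h2 h2
      apply mul_left_cancel₀ h4
      rw [← h, ht]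
      ring
    have hl : l ≠ 0 := by
      rintro h0
      rw [h0] at hdl
      simp [hdl] at hd
    have hsq : (g.val - l • (1 : Matrix (Fin 2) (Fin 2) (ZMod ℓ))) ^ 2 = 0 := by
      rw [pow_two, sub_mul, mul_sub, mul_sub, mul_self_eq, ht, hdl]
      simp only [smul_mul_assoc, mul_smul_comm, one_mul, mul_one]
      module
    have hN : (g.val - l • (1 : Matrix (Fin 2) (Fin 2) (ZMod ℓ))) ^ ℓ = 0 :=
      pow_eq_zero_of_le (Nat.Prime.two_le Fact.out) hsq
    rw [sub_pow_char_of_commute ℓ ((Commute.one_right _).smul_right _), smul_pow, one_pow,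
      ZMod.pow_card, sub_eq_zero] at hN
    have hval : (g ^ ℓ * g⁻¹).val =
        l⁻¹ • ((2 * l) • (1 : Matrix (Fin 2) (Fin 2) (ZMod ℓ)) - g.val) := by
      rw [Units.val_mul, Units.val_pow_eq_pow_val, hN, val_inv_eq, ht, hdl, smul_mul_smul_comm,
        one_mul]
      congr 1
      field_simp
    have hdet : (g ^ ℓ * g⁻¹).val.det = 1 := by
      rw [Units.val_mul, Units.val_pow_eq_pow_val, hN, Matrix.det_mul, det_val_inv, hdl,
        Matrix.det_smul, Matrix.det_one]
      simp
      field_simp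
    have htr : (g ^ ℓ * g⁻¹).val.trace = 2 := by
      rw [hval, Matrix.trace_smul, Matrix.trace_sub, Matrix.trace_smul, Matrix.trace_one, ht]
      simp
      field_simp
      ring
    have := hG _ (G.mul_mem (G.pow_mem hg ℓ) (G.inv_mem hg)) hdet htr
    rw [mul_inv_eq_one] at this
    rw [← this, mem_center_iff_isScalarMat, Units.val_pow_eq_pow_val, hN]
    simp [IsScalarMat]

lemma det_eq_one_and_trace_eq_two_of_pow_eq_one {g : GL2 ℓ} (h : g ^ ℓ = 1) :
    g.val.det = 1 ∧ g.val.trace = 2 := by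
  have hN : (g.val - 1) ^ ℓ = 0 := by
    rw [sub_pow_char_of_commute ℓ (Commute.one_right _), one_pow, ← Units.val_pow_eq_pow_val, h,
      Units.val_one, sub_self]
  have htr : (g.val - 1).trace = 0 := (Matrix.isNilpotent_trace_of_isNilpotent ⟨ℓ, hN⟩).eq_zero
  have hdet : (g.val - 1).det = 0 := by
    have := congrArg Matrix.det hN
    rw [Matrix.det_pow, Matrix.det_zero] at this
    exact eq_zero_of_pow_eq_zero this
  rw [Matrix.trace_fin_two] at htr ⊢
  rw [Matrix.det_fin_two] at hdet ⊢
  simp at htr hdet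
  constructor
  · linear_combination hdet + htr
  · linear_combination htr

lemma NoUnipotent.natCast_card_ne_zero {G : Subgroup (GL2 ℓ)} (hG : NoUnipotent G) :
    (Nat.card G : ZMod ℓ) ≠ 0 := by
  intro h0
  obtain ⟨g, hg⟩ := exists_prime_orderOf_dvd_card' (G := G) ℓ ((ZMod.natCast_eq_zero_iff _ _).mp h0)
  have hpow : (g : GL2 ℓ) ^ ℓ = 1 := by
    rw [← Subgroup.coe_pow, orderOf_dvd_iff_pow_eq_one.mp hg.dvd, Subgroup.coe_one]
  obtain ⟨hd, ht⟩ := det_eq_one_and_trace_eq_two_of_pow_eq_one hpow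
  have hg1 : g = 1 := Subtype.ext (hG g g.2 hd ht)
  rw [hg1, orderOf_one] at hg
  exact (Nat.Prime.one_lt Fact.out).ne hg

lemma NoUnipotent.exists_conjSubgroup_eq_of_three {G H K : Subgroup (GL2 ℓ)} (hG : NoUnipotent G)
    (hGH : sigSet G = sigSet H) (hGK : sigSet G = sigSet K) :
    (∃ c, conjSubgroup c G = H) ∨ (∃ c, conjSubgroup c G = K) ∨ (∃ c, conjSubgroup c H = K) := by
  have hH := hG.of_sigSet_eq hGH
  have hK := hG.of_sigSet_eq hGK
  exact _root_.exists_conjSubgroup_eq_of_three hG.isSeparableGroup hH.isSeparableGroup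
    hK.isSeparableGroup hG.natCast_card_ne_zero hH.natCast_card_ne_zero hK.natCast_card_ne_zero
    (detTraceSet_eq_of_sigSet_eq hGH) (detTraceSet_eq_of_sigSet_eq hGK)

end Signatures

section Unipotent

variable {F : Type*} [Field F]

/-- The upper triangular unipotent matrix with entry `x`. -/
def upperUnip (x : F) : GL (Fin 2) F :=
  ⟨!![1, x; 0, 1], !![1, -x; 0, 1], by simp [Matrix.one_fin_two], by simp [Matrix.one_fin_two]⟩

/-- The lower triangular unipotent matrix with entry `x`. -/
def lowerUnip (x : F) : GL (Fin 2) F :=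
  ⟨!![1, 0; x, 1], !![1, 0; -x, 1], by simp [Matrix.one_fin_two], by simp [Matrix.one_fin_two]⟩

lemma upperUnip_val (x : F) : (upperUnip x).val = !![1, x; 0, 1] := rfl

lemma lowerUnip_val (x : F) : (lowerUnip x).val = !![1, 0; x, 1] := rfl

lemma upperUnip_pow (x : F) (k : ℕ) : upperUnip x ^ k = upperUnip (k * x) := by
  induction k with
  | zero => apply Units.ext; simp [upperUnip_val, Matrix.one_fin_two]
  | succ k ih =>
    rw [pow_succ, ih]
    apply Units.ext
    simp [upperUnip_val]
    ring

lemma lowerUnip_pow (x : F) (k : ℕ) : lowerUnip x ^ k = lowerUnip (k * x) := by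
  induction k with
  | zero => apply Units.ext; simp [lowerUnip_val, Matrix.one_fin_two]
  | succ k ih =>
    rw [pow_succ, ih]
    apply Units.ext
    simp [lowerUnip_val]
    ring

/-- A matrix with nonzero lower left entry differs from a lower triangular one by upper triangular
unipotent factors. -/
lemma exists_lower_mem {G : Subgroup (GL (Fin 2) F)} (hU : ∀ x, upperUnip x ∈ G)
    {g : GL (Fin 2) F} (hc : g.val 1 0 ≠ 0) :
    ∃ k : GL (Fin 2) F, k.val = !![1, 0; g.val 1 0, g.val.det] ∧ (k ∈ G ↔ g ∈ G) := by
  refine ⟨upperUnip ((1 - g.val 0 0) / g.val 1 0) * g * upperUnip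
    (-(g.val 0 1 + (1 - g.val 0 0) / g.val 1 0 * g.val 1 1)), ?_, ?_⟩
  · rw [Units.val_mul, Units.val_mul, upperUnip_val, upperUnip_val, Matrix.det_fin_two]
    ext i j
    fin_cases i <;> fin_cases j <;>
      simp [Matrix.mul_apply, Matrix.vecMul, dotProduct, Fin.sum_univ_two] <;> grind
  · rw [Subgroup.mul_mem_cancel_right _ (hU _), Subgroup.mul_mem_cancel_left _ (hU _)]

lemma lowerUnip_mem_iff {G : Subgroup (GL (Fin 2) F)} (hU : ∀ x, upperUnip x ∈ G)
    {g : GL (Fin 2) F} (hc : g.val 1 0 ≠ 0) (hd : g.val.det = 1) :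
    lowerUnip (g.val 1 0) ∈ G ↔ g ∈ G := by
  obtain ⟨k, hk, hkG⟩ := exists_lower_mem hU hc
  rw [← hkG, show lowerUnip (g.val 1 0) = k from Units.ext (by rw [hk, hd, lowerUnip_val])]

/-- `G` contains the special linear group. -/
def ContainsSL (G : Subgroup (GL (Fin 2) F)) : Prop := ∀ g : GL (Fin 2) F, g.val.det = 1 → g ∈ G

lemma containsSL_of_unip_mem {G : Subgroup (GL (Fin 2) F)} (hU : ∀ x, upperUnip x ∈ G)
    (hL : ∀ x, lowerUnip x ∈ G) : ContainsSL G := by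
  intro g hd
  by_cases hc : g.val 1 0 = 0
  · have h1 : (g * lowerUnip 1).val 1 0 = g.val 1 1 := by
      rw [Units.val_mul, lowerUnip_val]
      simp [Matrix.mul_apply, Fin.sum_univ_two, hc]
    have h2 : g.val 1 1 ≠ 0 := by
      intro h0
      rw [Matrix.det_fin_two, hc, h0] at hd
      simp at hd
    have h3 : (g * lowerUnip 1).val.det = 1 := by
      rw [Units.val_mul, Matrix.det_mul, hd, lowerUnip_val]
      simp
    exact (Subgroup.mul_mem_cancel_right _ (hL 1)).mp
      ((lowerUnip_mem_iff hU (by rwa [h1]) h3).mp (hL _))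
  · exact (lowerUnip_mem_iff hU hc hd).mp (hL _)

lemma ContainsSL.conj {G : Subgroup (GL (Fin 2) F)} (hG : ContainsSL G) (c : GL (Fin 2) F) :
    ContainsSL (conjSubgroup c G) := by
  intro g hg
  have h := hG (c⁻¹ * g * c⁻¹⁻¹) (by rw [det_conj_val, hg])
  refine mem_conjSubgroup.mpr ⟨_, h, ?_⟩
  simp [mul_assoc]

lemma upperUnip_mem {ℓ : ℕ} [Fact (Nat.Prime ℓ)] {G : Subgroup (GL2 ℓ)} {c : ZMod ℓ} (hc : c ≠ 0)
    (h : upperUnip c ∈ G) (x : ZMod ℓ) : upperUnip x ∈ G := by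
  have := G.pow_mem h (x * c⁻¹).val
  rwa [upperUnip_pow, ZMod.natCast_zmod_val, inv_mul_cancel_right₀ hc] at this

lemma lowerUnip_mem {ℓ : ℕ} [Fact (Nat.Prime ℓ)] {G : Subgroup (GL2 ℓ)} {c : ZMod ℓ} (hc : c ≠ 0)
    (h : lowerUnip c ∈ G) (x : ZMod ℓ) : lowerUnip x ∈ G := by
  have := G.pow_mem h (x * c⁻¹).val
  rwa [lowerUnip_pow, ZMod.natCast_zmod_val, inv_mul_cancel_right₀ hc] at this

/-- `G` consists of upper triangular matrices and contains all the unipotent ones. -/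
structure IsFullTriangular (G : Subgroup (GL (Fin 2) F)) : Prop where
  upperUnip_mem : ∀ x, upperUnip x ∈ G
  apply_eq_zero : ∀ g ∈ G, g.val 1 0 = 0

lemma containsSL_or_isFullTriangular {ℓ : ℕ} [Fact (Nat.Prime ℓ)] {G : Subgroup (GL2 ℓ)}
    (h : upperUnip 1 ∈ G) : ContainsSL G ∨ IsFullTriangular G := by
  have hU := upperUnip_mem one_ne_zero h
  by_cases hall : ∀ g ∈ G, g.val 1 0 = 0
  · exact Or.inr ⟨hU, hall⟩
  left
  push Not at hall
  obtain ⟨g, hg, hc⟩ := hall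
  have hd := det_val_ne_zero g
  obtain ⟨k, hk, hkG⟩ := exists_lower_mem hU hc
  rw [← hkG] at hg
  have hmem : k * upperUnip 1 * k⁻¹ ∈ G := G.mul_mem (G.mul_mem hg h) (G.inv_mem hg)
  have hentry : (k * upperUnip 1 * k⁻¹).val 1 0 = -(g.val 1 0 ^ 2 / g.val.det) := by
    rw [Units.val_mul, Units.val_mul, val_inv_eq, hk, upperUnip_val]
    simp [Matrix.mul_apply, Fin.sum_univ_two, Matrix.det_fin_two, Matrix.trace_fin_two,
      Matrix.one_fin_two]
    field_simp
    ring
  have hne : (k * upperUnip 1 * k⁻¹).val 1 0 ≠ 0 := by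
    rw [hentry]
    exact neg_ne_zero.mpr (div_ne_zero (pow_ne_zero 2 hc) hd)
  have hdet : (k * upperUnip 1 * k⁻¹).val.det = 1 := by
    rw [det_conj_val, upperUnip_val]
    simp
  exact containsSL_of_unip_mem hU (lowerUnip_mem hne ((lowerUnip_mem_iff hU hne hdet).mpr hmem))

/-- A subgroup with a nontrivial unipotent element contains the special linear group or is
conjugate to a group of upper triangular matrices. -/
lemma containsSL_or_exists_isFullTriangular {ℓ : ℕ} [Fact (Nat.Prime ℓ)] {G : Subgroup (GL2 ℓ)}
    (hG : ¬ NoUnipotent G) : ContainsSL G ∨ ∃ c, IsFullTriangular (conjSubgroup c G) := by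
  simp only [NoUnipotent] at hG
  push Not at hG
  obtain ⟨g, hg, hd, ht, hne⟩ := hG
  have hgc : g ∉ Subgroup.center (GL2 ℓ) := fun hgc => hne
    (eq_of_mem_center (Subgroup.one_mem _) hgc (by simp [hd]) (by simp [ht]))
  have huc : upperUnip (1 : ZMod ℓ) ∉ Subgroup.center (GL2 ℓ) := by
    rw [mem_center_iff_isScalarMat, upperUnip_val]
    simp [IsScalarMat]
  obtain ⟨c, hc⟩ := exists_conj_of_notMem_center hgc huc
    (by rw [hd, upperUnip_val]; simp)
    (by rw [ht, upperUnip_val]; simp [Matrix.trace_fin_two]; norm_num)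
  have hmem : upperUnip 1 ∈ conjSubgroup c G := mem_conjSubgroup.mpr ⟨g, hg, hc⟩
  rcases containsSL_or_isFullTriangular hmem with h | h
  · left
    have := h.conj c⁻¹
    rwa [conjSubgroup_conjSubgroup, inv_mul_cancel, conjSubgroup_one] at this
  · exact Or.inr ⟨c, h⟩

end Unipotent

section Triangular

variable {F : Type*} [Field F]

/-- A finite field has an element that is not the sum of a unit and its inverse. -/
lemma exists_ne_add_of_mul_eq_one [Finite F] : ∃ t : F, ∀ a b : F, a * b = 1 → a + b ≠ t := by
  by_contra! h
  have hsurj : Function.Surjective fun u : Fˣ => (u : F) + (u⁻¹ : Fˣ) := by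
    intro t
    obtain ⟨a, b, hab, rfl⟩ := h t
    exact ⟨⟨a, b, hab, by rw [mul_comm, hab]⟩, rfl⟩
  have h1 := Nat.card_le_card_of_surjective _ hsurj
  rw [Nat.card_units] at h1
  have : 0 < Nat.card F := Nat.card_pos
  omega

lemma ContainsSL.of_detTraceSet_eq {ℓ : ℕ} [Fact (Nat.Prime ℓ)] {G H : Subgroup (GL2 ℓ)}
    (hG : ContainsSL G) (hH : ¬ NoUnipotent H) (h : detTraceSet G = detTraceSet H) :
    ContainsSL H := by
  refine (containsSL_or_exists_isFullTriangular hH).resolve_right ?_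
  rintro ⟨c, hc⟩
  obtain ⟨t, ht⟩ := exists_ne_add_of_mul_eq_one (F := ZMod ℓ)
  have hdet : (!![0, -1; 1, t] : Matrix (Fin 2) (Fin 2) (ZMod ℓ)).det = 1 := by simp
  obtain ⟨k, hk, hd, htr⟩ := exists_mem_of_detTraceSet_eq
    (h.trans (detTraceSet_conjSubgroup c H).symm)
    (hG (Matrix.GeneralLinearGroup.mkOfDetNeZero !![0, -1; 1, t] (by simp)) hdet)
  have h0 := hc.apply_eq_zero k hk
  refine ht (k.val 0 0) (k.val 1 1) ?_ ?_
  · have : k.val.det = 1 := hd.trans hdet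
    rwa [Matrix.det_fin_two, h0, mul_zero, sub_zero] at this
  · have : k.val.trace = t := htr.trans
      (show (!![0, -1; 1, t] : Matrix (Fin 2) (Fin 2) (ZMod ℓ)).trace = t by simp)
    rwa [Matrix.trace_fin_two] at this

lemma ContainsSL.le {G H : Subgroup (GL (Fin 2) F)} (hH : ContainsSL H)
    (h : detTraceSet G = detTraceSet H) : G ≤ H := by
  intro g hg
  obtain ⟨k, hk, hd, -⟩ := exists_mem_of_detTraceSet_eq h hg
  refine (Subgroup.mul_mem_cancel_right _ (H.inv_mem hk)).mp (hH (g * k⁻¹) ?_)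
  rw [Units.val_mul, Matrix.det_mul, det_val_inv, hd, mul_inv_cancel₀ (det_val_ne_zero g)]

/-- The endomorphism `x ↦ (det x)⁻¹ x` of `GL₂`. -/
def detTwist : GL (Fin 2) F →* GL (Fin 2) F where
  toFun x := Matrix.GeneralLinearGroup.scalar (Fin 2) (Matrix.GeneralLinearGroup.det x)⁻¹ * x
  map_one' := by simp
  map_mul' x y := by
    rw [map_mul, mul_inv, map_mul]
    exact Commute.mul_mul_mul_comm (Matrix.GeneralLinearGroup.scalar_commute _ x) _ y

lemma detTwist_val (x : GL (Fin 2) F) : (detTwist x).val = x.val.det⁻¹ • x.val := by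
  change (Matrix.GeneralLinearGroup.scalar (Fin 2) (Matrix.GeneralLinearGroup.det x)⁻¹).val * x.val
    = _
  rw [Matrix.GeneralLinearGroup.coe_scalar, Matrix.smul_eq_diagonal_mul, Units.val_inv_eq_inv_val]
  rfl

lemma detTwist_detTwist (x : GL (Fin 2) F) : detTwist (detTwist x) = x := by
  apply Units.ext
  have := det_val_ne_zero x
  rw [detTwist_val, detTwist_val, Matrix.det_smul, smul_smul]
  simp
  field_simp
  simp

lemma comap_detTwist_comap_detTwist (G : Subgroup (GL (Fin 2) F)) :
    (G.comap detTwist).comap detTwist = G := by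
  ext x
  simp [detTwist_detTwist]

lemma IsFullTriangular.mem_of_diag_eq {G : Subgroup (GL (Fin 2) F)} (hG : IsFullTriangular G)
    {g k : GL (Fin 2) F} (hk : k ∈ G) (hg : g.val 1 0 = 0) (h0 : g.val 0 0 = k.val 0 0)
    (h1 : g.val 1 1 = k.val 1 1) : g ∈ G := by
  have hk0 := hG.apply_eq_zero k hk
  have hne : k.val 1 1 ≠ 0 := by
    intro h
    apply det_val_ne_zero k
    rw [Matrix.det_fin_two, h, hk0]
    simp
  have : g = upperUnip ((g.val 0 1 - k.val 0 1) / k.val 1 1) * k := by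
    apply Units.ext
    rw [Units.val_mul, upperUnip_val]
    ext i j
    fin_cases i <;> fin_cases j <;>
      simp [Matrix.mul_apply, Fin.sum_univ_two, *]
  rw [this]
  exact G.mul_mem (hG.upperUnip_mem _) hk

lemma IsFullTriangular.le_or_le {G H : Subgroup (GL (Fin 2) F)} (hG : IsFullTriangular G)
    (hH : IsFullTriangular H) (h : detTraceSet G = detTraceSet H) :
    G ≤ H ∨ G ≤ H.comap detTwist := by
  rw [← SubgroupClass.subset_union]
  intro g hg
  obtain ⟨k, hk, hd, ht⟩ := exists_mem_of_detTraceSet_eq h hg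
  have hg0 := hG.apply_eq_zero g hg
  have hk0 := hH.apply_eq_zero k hk
  have hne := det_val_ne_zero g
  have hdet := Matrix.det_fin_two g.val
  rw [hg0, mul_zero, sub_zero] at hdet
  rw [Matrix.det_fin_two k.val, hk0, mul_zero, sub_zero, hdet] at hd
  rw [Matrix.trace_fin_two, Matrix.trace_fin_two] at ht
  have hprod : (k.val 0 0 - g.val 0 0) * (k.val 0 0 - g.val 1 1) = 0 := by
    linear_combination (k.val 0 0) * ht - hd
  rcases mul_eq_zero.mp hprod with e | e
  · rw [sub_eq_zero] at e
    rw [e] at ht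
    exact Or.inl (hH.mem_of_diag_eq hk hg0 e.symm (add_left_cancel ht).symm)
  · right
    rw [sub_eq_zero] at e
    rw [e, add_comm] at ht
    have hinv : ((detTwist g)⁻¹).val = g.val.trace • 1 - g.val := by
      rw [← map_inv, detTwist_val, det_val_inv, inv_inv, val_inv_eq, smul_smul,
        mul_inv_cancel₀ hne, one_smul]
    have : (detTwist g)⁻¹ ∈ H := by
      refine hH.mem_of_diag_eq hk ?_ ?_ ?_
      · simp [hinv, hg0]
      · simp [hinv, Matrix.trace_fin_two, e]
      · simp [hinv, Matrix.trace_fin_two, add_right_cancel ht]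
    exact (inv_mem_iff (H := H)).mp this

lemma IsFullTriangular.eq_or_eq {G H : Subgroup (GL (Fin 2) F)} (hG : IsFullTriangular G)
    (hH : IsFullTriangular H) (h : detTraceSet G = detTraceSet H) :
    G = H ∨ G = H.comap detTwist := by
  have key : ∀ {K L : Subgroup (GL (Fin 2) F)}, K ≤ L.comap detTwist → K.comap detTwist ≤ L := by
    intro K L hKL
    have := Subgroup.comap_mono (f := detTwist) hKL
    rwa [comap_detTwist_comap_detTwist] at this
  rcases hG.le_or_le hH h with h1 | h1 <;> rcases hH.le_or_le hG h.symm with h2 | h2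
  · exact Or.inl (h1.antisymm h2)
  · exact Or.inl (h1.antisymm (h2.trans (key (h1.trans h2))))
  · exact Or.inl ((h1.trans (key (h2.trans h1))).antisymm h2)
  · exact Or.inr (h1.antisymm (key h2))

lemma IsFullTriangular.eq_of_three {G H K : Subgroup (GL (Fin 2) F)} (hG : IsFullTriangular G)
    (hH : IsFullTriangular H) (hK : IsFullTriangular K) (hGH : detTraceSet G = detTraceSet H)
    (hGK : detTraceSet G = detTraceSet K) : G = H ∨ G = K ∨ H = K := by
  rcases hG.eq_or_eq hH hGH with h1 | h1
  · exact Or.inl h1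
  rcases hG.eq_or_eq hK hGK with h2 | h2
  · exact Or.inr (Or.inl h2)
  refine Or.inr (Or.inr ?_)
  rw [← comap_detTwist_comap_detTwist H, ← h1, h2, comap_detTwist_comap_detTwist]

/-- Among three subgroups of `GL₂(ℤ/ℓℤ)` with nontrivial unipotents and the same determinants and
traces, two are conjugate. -/
lemma exists_conjSubgroup_eq_of_not_noUnipotent {ℓ : ℕ} [Fact (Nat.Prime ℓ)]
    {G H K : Subgroup (GL2 ℓ)} (hG : ¬ NoUnipotent G) (hH : ¬ NoUnipotent H)
    (hK : ¬ NoUnipotent K) (hGH : detTraceSet G = detTraceSet H)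
    (hGK : detTraceSet G = detTraceSet K) :
    (∃ c, conjSubgroup c G = H) ∨ (∃ c, conjSubgroup c G = K) ∨ (∃ c, conjSubgroup c H = K) := by
  by_cases hsl : ContainsSL G
  · left
    refine ⟨1, ?_⟩
    rw [conjSubgroup_one]
    exact ((hsl.of_detTraceSet_eq hH hGH).le hGH).antisymm (hsl.le hGH.symm)
  obtain ⟨a, ha⟩ := (containsSL_or_exists_isFullTriangular hG).resolve_left hsl
  obtain ⟨b, hb⟩ := (containsSL_or_exists_isFullTriangular hH).resolve_left
    fun h => hsl (h.of_detTraceSet_eq hG hGH.symm)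
  obtain ⟨d, hd⟩ := (containsSL_or_exists_isFullTriangular hK).resolve_left
    fun h => hsl (h.of_detTraceSet_eq hG hGK.symm)
  have key : ∀ {x y : GL2 ℓ} {L M : Subgroup (GL2 ℓ)}, conjSubgroup x L = conjSubgroup y M →
      ∃ c, conjSubgroup c L = M := by
    intro x y L M h
    refine ⟨y⁻¹ * x, ?_⟩
    rw [← conjSubgroup_conjSubgroup, h, conjSubgroup_conjSubgroup, inv_mul_cancel,
      conjSubgroup_one]
  rcases ha.eq_of_three hb hd (by simpa only [detTraceSet_conjSubgroup] using hGH)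
    (by simpa only [detTraceSet_conjSubgroup] using hGK) with h | h | h
  · exact Or.inl (key h)
  · exact Or.inr (Or.inl (key h))
  · exact Or.inr (Or.inr (key h))

end Triangular

lemma ConjSub.symm {ℓ : ℕ} {H K : Subgroup (GL2 ℓ)} (h : ConjSub H K) : ConjSub K H := by
  obtain ⟨c, rfl⟩ := h
  refine ⟨c⁻¹, ?_⟩
  change conjSubgroup c⁻¹ (conjSubgroup c H) = H
  rw [conjSubgroup_conjSubgroup, inv_mul_cancel, conjSubgroup_one]

/-- Let `ℓ` be a prime and let `G`, `H₁`, `H₂` be subgroups of `GL₂(ℤ/ℓℤ)` with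
`sig(H₁) = sig(H₂) = sig(G)`.  If neither `H₁` nor `H₂` is conjugate to `G`, then `H₁`
and `H₂` are conjugate to each other; that is, for every subgroup `G` there is at most
one conjugacy class of subgroups not conjugate to `G` having the same signature as `G`. -/
theorem stmt14 (ℓ : ℕ) [Fact (Nat.Prime ℓ)]
    (G H₁ H₂ : Subgroup (GL2 ℓ))
    (h1 : sigSet H₁ = sigSet G) (h2 : sigSet H₂ = sigSet G)
    (n1 : ¬ ConjSub H₁ G) (n2 : ¬ ConjSub H₂ G) :
    ConjSub H₁ H₂ := by
  have key : ConjSub G H₁ ∨ ConjSub G H₂ ∨ ConjSub H₁ H₂ := by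
    by_cases hG : NoUnipotent G
    · exact hG.exists_conjSubgroup_eq_of_three h1.symm h2.symm
    · exact exists_conjSubgroup_eq_of_not_noUnipotent hG (fun h => hG (h.of_sigSet_eq h1))
        (fun h => hG (h.of_sigSet_eq h2)) (detTraceSet_eq_of_sigSet_eq h1.symm)
        (detTraceSet_eq_of_sigSet_eq h2.symm)
  exact (key.resolve_left fun h => n1 h.symm).resolve_left fun h => n2 h.symm
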